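/- arXiv:1903.10799 — 3 statements merged into one kernel-verified Lean document; each statement's English description precedes it below -/
import Mathlib

section
/- (Trigub, 1965) For every r ∈ ℕ there exist constants 0 < c₁ ≤ c₂ and a sequence of linear operators T_n (n ∈ ℕ) mapping the space of continuous 2π-periodic functions into the trigonometric polynomials of degree at most n, such that for every continuous 2π-periodic f : ℝ → ℝ and every n ∈ ℕ: c₁·ω_r(f, 1/n) ≤ sup_{x∈ℝ} |f(x) − (T_n f)(x)| ≤ c₂·ω_r(f, 1/n). -/
open Real

/-- The `r`-th modulus of smoothness
`ω_r(f,h) = sup_{0≤t≤h} sup_x |Σ_{k=0}^r (−1)^{r−k} C(r,k) f(x+kt)|`. -/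
noncomputable def modulusSmoothness (r : ℕ) (f : ℝ → ℝ) (h : ℝ) : ℝ :=
  sSup {v : ℝ | ∃ t x : ℝ, 0 ≤ t ∧ t ≤ h ∧
    v = |∑ k ∈ Finset.range (r + 1), (-1 : ℝ) ^ (r - k) * (r.choose k : ℝ) * f (x + k * t)|}

/-- `g` is a real trigonometric polynomial of degree at most `n`. -/
def IsRealTrigPoly (n : ℕ) (g : ℝ → ℝ) : Prop :=
  ∃ a b : ℕ → ℝ, g = fun x : ℝ =>
    ∑ k ∈ Finset.range (n + 1), (a k * Real.cos (k * x) + b k * Real.sin (k * x))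

namespace Trig

/-- trigonometric polynomials of degree at most `n` -/
def TP (n : ℕ) : Submodule ℝ (ℝ → ℝ) :=
  Submodule.span ℝ {g | ∃ k : ℕ, k ≤ n ∧ (g = (fun x => cos (k * x)) ∨ g = (fun x => sin (k * x)))}

lemma cos_mem {k n : ℕ} (h : k ≤ n) : (fun x : ℝ => cos (k * x)) ∈ TP n :=
  Submodule.subset_span ⟨k, h, Or.inl rfl⟩

lemma sin_mem {k n : ℕ} (h : k ≤ n) : (fun x : ℝ => sin (k * x)) ∈ TP n :=
  Submodule.subset_span ⟨k, h, Or.inr rfl⟩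

lemma TP_mono {m n : ℕ} (h : m ≤ n) : TP m ≤ TP n := by
  apply Submodule.span_mono
  rintro g ⟨k, hk, hg⟩
  exact ⟨k, hk.trans h, hg⟩

lemma TP_ind {n : ℕ} {p : (ℝ → ℝ) → Prop}
    (hc : ∀ k : ℕ, k ≤ n → p (fun x => cos (k * x)))
    (hs : ∀ k : ℕ, k ≤ n → p (fun x => sin (k * x)))
    (h0 : p 0) (hadd : ∀ f g, f ∈ TP n → g ∈ TP n → p f → p g → p (f + g))
    (hsm : ∀ (c : ℝ) f, f ∈ TP n → p f → p (c • f)) {f : ℝ → ℝ} (hf : f ∈ TP n) : p f := by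
  induction hf using Submodule.span_induction with
  | mem x h =>
    obtain ⟨k, hk, rfl | rfl⟩ := h
    · exact hc k hk
    · exact hs k hk
  | zero => exact h0
  | add x y hx hy h1 h2 => exact hadd x y hx hy h1 h2
  | smul a x hx h => exact hsm a x hx h

/-- continuous periodic functions -/
def E : Submodule ℝ (ℝ → ℝ) where
  carrier := {f | Continuous f ∧ Function.Periodic f (2 * π)}
  add_mem' := fun h1 h2 => ⟨h1.1.add h2.1, h1.2.add h2.2⟩
  zero_mem' := ⟨continuous_const, fun _ => rfl⟩
  smul_mem' := fun c _ h => ⟨h.1.const_smul c, h.2.smul c⟩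

lemma cos_per (k : ℕ) : Function.Periodic (fun x : ℝ => cos (k * x)) (2 * π) := by
  intro x
  simp only [mul_add]
  exact cos_add_nat_mul_two_pi _ k

lemma sin_per (k : ℕ) : Function.Periodic (fun x : ℝ => sin (k * x)) (2 * π) := by
  intro x
  simp only [mul_add]
  exact sin_add_nat_mul_two_pi _ k

lemma TP_le_E (n : ℕ) : TP n ≤ E := by
  apply Submodule.span_le.2
  rintro g ⟨k, hk, rfl | rfl⟩
  · exact ⟨by fun_prop, cos_per k⟩
  · exact ⟨by fun_prop, sin_per k⟩

lemma TP_deriv {n : ℕ} {p : ℝ → ℝ} (hp : p ∈ TP n) : Differentiable ℝ p ∧ deriv p ∈ TP n := by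
  refine TP_ind (n := n) (p := fun p => Differentiable ℝ p ∧ deriv p ∈ TP n) ?_ ?_ ?_ ?_ ?_ hp
  · intro k hk
    refine ⟨by fun_prop, ?_⟩
    have : deriv (fun x : ℝ => cos (k * x)) = (-(k:ℝ)) • (fun x : ℝ => sin (k * x)) := by
      funext x
      have h : HasDerivAt (fun x : ℝ => cos (k * x)) (-sin (k * x) * (k * 1)) x :=
        ((hasDerivAt_id x).const_mul (k:ℝ)).cos
      rw [h.deriv]; simp; ring
    rw [this]
    exact Submodule.smul_mem _ _ (sin_mem hk)
  · intro k hk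
    refine ⟨by fun_prop, ?_⟩
    have : deriv (fun x : ℝ => sin (k * x)) = ((k:ℝ)) • (fun x : ℝ => cos (k * x)) := by
      funext x
      have h : HasDerivAt (fun x : ℝ => sin (k * x)) (cos (k * x) * (k * 1)) x :=
        ((hasDerivAt_id x).const_mul (k:ℝ)).sin
      rw [h.deriv]; simp; ring
    rw [this]
    exact Submodule.smul_mem _ _ (cos_mem hk)
  · refine ⟨differentiable_const 0, ?_⟩
    have : deriv (0 : ℝ → ℝ) = 0 := by funext x; simp
    rw [this]; exact Submodule.zero_mem _
  · rintro f g - - ⟨h1, h2⟩ ⟨h3, h4⟩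
    refine ⟨h1.add h3, ?_⟩
    have : deriv (f + g) = deriv f + deriv g := by
      funext x; exact deriv_add (h1 x) (h3 x)
    rw [this]; exact Submodule.add_mem _ h2 h4
  · rintro c f - ⟨h1, h2⟩
    refine ⟨h1.const_smul c, ?_⟩
    have : deriv (c • f) = c • deriv f := by
      funext x; exact deriv_const_smul c (h1 x)
    rw [this]; exact Submodule.smul_mem _ _ h2

/-- convolution -/
noncomputable def C (K f : ℝ → ℝ) : ℝ → ℝ := fun x => (1 / (2 * π)) * ∫ t in (-π)..π, K t * f (x - t)

lemma C_add {K f g : ℝ → ℝ} (hK : Continuous K) (hf : Continuous f) (hg : Continuous g) :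
    C K (f + g) = C K f + C K g := by
  funext x
  simp only [C, Pi.add_apply, mul_add]
  rw [intervalIntegral.integral_add, mul_add]
  · exact Continuous.intervalIntegrable (by fun_prop) _ _
  · exact Continuous.intervalIntegrable (by fun_prop) _ _

lemma C_smul {K f : ℝ → ℝ} (c : ℝ) : C K (c • f) = c • C K f := by
  funext x
  simp only [C, Pi.smul_apply, smul_eq_mul]
  rw [mul_left_comm, ← intervalIntegral.integral_const_mul c]
  congr 2
  funext t; ring

lemma C_sub {K f g : ℝ → ℝ} (hK : Continuous K) (hf : Continuous f) (hg : Continuous g) :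
    C K (f - g) = C K f - C K g := by
  have h : f - g = f + (-1 : ℝ) • g := by simp [sub_eq_add_neg]
  rw [h, C_add hK hf (hg.const_smul _), C_smul]
  simp [sub_eq_add_neg]

lemma C_addK {K L f : ℝ → ℝ} (hK : Continuous K) (hL : Continuous L) (hf : Continuous f) :
    C (K + L) f = C K f + C L f := by
  funext x
  simp only [C, Pi.add_apply, add_mul]
  rw [intervalIntegral.integral_add, mul_add]
  · exact Continuous.intervalIntegrable (by fun_prop) _ _
  · exact Continuous.intervalIntegrable (by fun_prop) _ _

lemma C_smulK {K f : ℝ → ℝ} (c : ℝ) : C (c • K) f = c • C K f := by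
  funext x
  simp only [C, Pi.smul_apply, smul_eq_mul]
  rw [mul_left_comm, ← intervalIntegral.integral_const_mul c]
  congr 2
  funext t; ring

lemma C_alt {K f : ℝ → ℝ} (hKp : Function.Periodic K (2 * π))
    (hfp : Function.Periodic f (2 * π)) (x : ℝ) :
    C K f x = (1 / (2 * π)) * ∫ t in (-π)..π, K (x - t) * f t := by
  unfold C
  congr 1
  have h1 : (∫ t in (-π)..π, K t * f (x - t)) = ∫ t in (-π)..π, (fun s => K (x - s) * f s) (x - t) := by
    simp
  rw [h1, intervalIntegral.integral_comp_sub_left (fun s => K (x - s) * f s) x]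
  have hper : Function.Periodic (fun s => K (x - s) * f s) (2 * π) := by
    intro s
    simp only [hfp s]
    congr 1
    rw [show x - (s + 2 * π) = x - s - 2 * π by ring, hKp.sub_eq]
  have := hper.intervalIntegral_add_eq (x - π) (-π)
  rw [show x - -π = x - π + 2 * π by ring, this]
  congr 1; ring

lemma C_comm {K L f : ℝ → ℝ} (hK : Continuous K) (hL : Continuous L) (hf : Continuous f) :
    C K (C L f) = C L (C K f) := by
  funext x
  simp only [C]
  congr 1
  simp only [← intervalIntegral.integral_const_mul]
  rw [MeasureTheory.intervalIntegral_intervalIntegral_swap]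
  · congr 1; funext t; congr 1; funext s
    rw [show x - s - t = x - t - s by ring]; ring
  · refine MeasureTheory.IntegrableOn.mono_set (t := Set.uIcc (-π) π ×ˢ Set.uIcc (-π) π) ?_
      (Set.prod_mono Set.uIoc_subset_uIcc Set.uIoc_subset_uIcc)
    apply ContinuousOn.integrableOn_compact (isCompact_uIcc.prod isCompact_uIcc)
    apply Continuous.continuousOn
    unfold Function.uncurry
    fun_prop

lemma C_mem {n : ℕ} {K f : ℝ → ℝ} (hK : K ∈ TP n) (hf : f ∈ E) : C K f ∈ TP n := by
  refine TP_ind (n := n) (p := fun K => C K f ∈ TP n) ?_ ?_ ?_ ?_ ?_ hK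
  · intro k hk
    have : C (fun x : ℝ => cos (k * x)) f =
        ((1 / (2 * π)) * ∫ t in (-π)..π, cos (k * t) * f t) • (fun x : ℝ => cos (k * x)) +
        ((1 / (2 * π)) * ∫ t in (-π)..π, sin (k * t) * f t) • (fun x : ℝ => sin (k * x)) := by
      funext x
      rw [C_alt (cos_per k) hf.2]
      simp only [Pi.add_apply, Pi.smul_apply, smul_eq_mul]
      rw [mul_assoc, mul_assoc, ← mul_add, ← intervalIntegral.integral_mul_const,
        ← intervalIntegral.integral_mul_const, ← intervalIntegral.integral_add]
      · congr 2; funext t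
        rw [mul_sub, cos_sub]; ring
      · have := hf.1
        exact Continuous.intervalIntegrable (by fun_prop) _ _
      · have := hf.1
        exact Continuous.intervalIntegrable (by fun_prop) _ _
    rw [this]
    exact Submodule.add_mem _ (Submodule.smul_mem _ _ (cos_mem hk)) (Submodule.smul_mem _ _ (sin_mem hk))
  · intro k hk
    have : C (fun x : ℝ => sin (k * x)) f =
        ((1 / (2 * π)) * ∫ t in (-π)..π, cos (k * t) * f t) • (fun x : ℝ => sin (k * x)) +
        ((1 / (2 * π)) * ∫ t in (-π)..π, - sin (k * t) * f t) • (fun x : ℝ => cos (k * x)) := by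
      funext x
      rw [C_alt (sin_per k) hf.2]
      simp only [Pi.add_apply, Pi.smul_apply, smul_eq_mul]
      rw [mul_assoc, mul_assoc, ← mul_add, ← intervalIntegral.integral_mul_const,
        ← intervalIntegral.integral_mul_const, ← intervalIntegral.integral_add]
      · congr 2; funext t
        rw [mul_sub, sin_sub]; ring
      · have := hf.1
        exact Continuous.intervalIntegrable (by fun_prop) _ _
      · have := hf.1
        exact Continuous.intervalIntegrable (by fun_prop) _ _
    rw [this]
    exact Submodule.add_mem _ (Submodule.smul_mem _ _ (sin_mem hk)) (Submodule.smul_mem _ _ (cos_mem hk))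
  · have : C 0 f = 0 := by funext x; simp [C]
    rw [this]; exact Submodule.zero_mem _
  · intro K L hK hL h1 h2
    rw [C_addK (TP_le_E _ hK).1 (TP_le_E _ hL).1 hf.1]
    exact Submodule.add_mem _ h1 h2
  · intro c K hK h
    rw [C_smulK]
    exact Submodule.smul_mem _ _ h

/-- sup bound -/
def Bd (f : ℝ → ℝ) (M : ℝ) : Prop := ∀ x, |f x| ≤ M

lemma Bd.nonneg {f M} (h : Bd f M) : 0 ≤ M := (abs_nonneg _).trans (h 0)
lemma Bd.mono {f M N} (h : Bd f M) (h' : M ≤ N) : Bd f N := fun x => (h x).trans h'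
lemma Bd.add {f g M N} (h : Bd f M) (h' : Bd g N) : Bd (f + g) (M + N) :=
  fun x => (abs_add_le _ _).trans (add_le_add (h x) (h' x))
lemma Bd.sub {f g M N} (h : Bd f M) (h' : Bd g N) : Bd (f - g) (M + N) :=
  fun x => (abs_sub _ _).trans (add_le_add (h x) (h' x))
lemma Bd.smul {f M} (c : ℝ) (h : Bd f M) : Bd (c • f) (|c| * M) := fun x => by
  simp only [Pi.smul_apply, smul_eq_mul, abs_mul]
  exact mul_le_mul_of_nonneg_left (h x) (abs_nonneg _)

lemma C_bd {K f : ℝ → ℝ} (hK : Continuous K) (hf : Continuous f) {κ M : ℝ}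
    (hκ : (1 / (2 * π)) * ∫ t in (-π)..π, |K t| ≤ κ) (hM : Bd f M) : Bd (C K f) (κ * M) := by
  intro x
  have hM0 := hM.nonneg
  unfold C
  rw [abs_mul, abs_of_pos (by positivity : 0 < 1 / (2 * π))]
  have h1 : |∫ t in (-π)..π, K t * f (x - t)| ≤ (∫ t in (-π)..π, |K t|) * M := by
    rw [← intervalIntegral.integral_mul_const]
    refine (intervalIntegral.abs_integral_le_integral_abs (by linarith [pi_pos])).trans ?_
    apply intervalIntegral.integral_mono_on (by linarith [pi_pos])
    · exact Continuous.intervalIntegrable (by fun_prop) _ _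
    · exact Continuous.intervalIntegrable (by fun_prop) _ _
    · intro t _
      rw [abs_mul]
      exact mul_le_mul_of_nonneg_left (hM _) (abs_nonneg _)
  calc _ ≤ 1 / (2 * π) * ((∫ t in (-π)..π, |K t|) * M) := by gcongr
    _ = (1 / (2 * π) * (∫ t in (-π)..π, |K t|)) * M := by ring
    _ ≤ _ := by gcongr

lemma C_deriv {K f f' : ℝ → ℝ} (hK : Continuous K) (hf : ∀ x, HasDerivAt f (f' x) x)
    (hf' : f' ∈ E) (x : ℝ) : HasDerivAt (C K f) (C K f' x) x := by
  have hfc : Continuous f := continuous_iff_continuousAt.2 fun x => (hf x).continuousAt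
  have hfc' := hf'.1
  unfold C
  apply HasDerivAt.const_mul
  have hb : ∃ M, ∀ x, |f' x| ≤ M := by
    obtain ⟨M, hM⟩ := (hf'.2.compact_of_continuous (by positivity) hf'.1).isBounded.exists_norm_le
    exact ⟨M, fun x => hM _ ⟨x, rfl⟩⟩
  obtain ⟨M, hM⟩ := hb
  refine (intervalIntegral.hasDerivAt_integral_of_dominated_loc_of_deriv_le
    (F := fun x t => K t * f (x - t)) (F' := fun x t => K t * f' (x - t))
    (bound := fun t => |K t| * M) (s := Set.univ) Filter.univ_mem ?_ ?_ ?_ ?_ ?_ ?_).2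
  · exact Filter.Eventually.of_forall fun x => Continuous.aestronglyMeasurable (by fun_prop)
  · exact Continuous.intervalIntegrable (by fun_prop) _ _
  · exact Continuous.aestronglyMeasurable (by fun_prop)
  · refine Filter.Eventually.of_forall fun t _ x _ => ?_
    rw [norm_mul]
    exact mul_le_mul_of_nonneg_left (hM _) (abs_nonneg _)
  · exact Continuous.intervalIntegrable (by fun_prop) _ _
  · refine Filter.Eventually.of_forall fun t _ x _ => ?_
    apply HasDerivAt.const_mul
    simpa using (hf (x - t)).comp_sub_const x t

end Trig

namespace Trig

/-- autocorrelation kernel -/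
noncomputable def Q (a : ℕ → ℝ) (N : ℕ) : ℝ → ℝ := fun t =>
  ∑ j ∈ Finset.range N, ∑ k ∈ Finset.range N, a j * a k * cos (((j : ℝ) - k) * t)

lemma Q_eq_sq (a : ℕ → ℝ) (N : ℕ) (t : ℝ) : Q a N t =
    (∑ j ∈ Finset.range N, a j * cos (j * t)) ^ 2 + (∑ j ∈ Finset.range N, a j * sin (j * t)) ^ 2 := by
  unfold Q
  rw [sq, sq, Finset.sum_mul_sum, Finset.sum_mul_sum, ← Finset.sum_add_distrib]
  refine Finset.sum_congr rfl fun j _ => ?_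
  rw [← Finset.sum_add_distrib]
  refine Finset.sum_congr rfl fun k _ => ?_
  rw [sub_mul, cos_sub]; ring

lemma Q_nonneg (a : ℕ → ℝ) (N : ℕ) (t : ℝ) : 0 ≤ Q a N t := by
  rw [Q_eq_sq]; positivity

lemma Q_even (a : ℕ → ℝ) (N : ℕ) (t : ℝ) : Q a N (-t) = Q a N t := by
  simp [Q_eq_sq, Finset.sum_neg_distrib]

lemma Q_cont (a : ℕ → ℝ) (N : ℕ) : Continuous (Q a N) := by
  unfold Q; fun_prop

lemma Q_mem (a : ℕ → ℝ) (n : ℕ) : Q a (n + 1) ∈ TP n := by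
  have : Q a (n + 1) = ∑ j ∈ Finset.range (n + 1), ∑ k ∈ Finset.range (n + 1),
      (a j * a k) • (fun t : ℝ => cos (((j : ℝ) - k) * t)) := by
    funext t; simp [Q]
  rw [this]
  refine Submodule.sum_mem _ fun j hj => Submodule.sum_mem _ fun k hk => Submodule.smul_mem _ _ ?_
  rw [Finset.mem_range] at hj hk
  rcases le_total k j with h | h
  · have h2 := cos_mem (k := j - k) (n := n) (by omega)
    rw [Nat.cast_sub h] at h2
    exact h2
  · have h2 := cos_mem (k := k - j) (n := n) (by omega)
    rw [Nat.cast_sub h] at h2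
    convert h2 using 2 with t
    rw [← cos_neg]; congr 1; ring

/-- mean over a period -/
noncomputable def mean (f : ℝ → ℝ) : ℝ := (1 / (2 * π)) * ∫ t in (-π)..π, f t

lemma mean_add {f g : ℝ → ℝ} (hf : Continuous f) (hg : Continuous g) :
    mean (fun t => f t + g t) = mean f + mean g := by
  unfold mean
  rw [intervalIntegral.integral_add (hf.intervalIntegrable _ _) (hg.intervalIntegrable _ _), mul_add]

lemma mean_mul (c : ℝ) (f : ℝ → ℝ) : mean (fun t => c * f t) = c * mean f := by
  unfold mean
  rw [intervalIntegral.integral_const_mul, mul_left_comm]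

lemma mean_mono {f g : ℝ → ℝ} (hf : Continuous f) (hg : Continuous g)
    (h : ∀ t, -π ≤ t → t ≤ π → f t ≤ g t) : mean f ≤ mean g := by
  unfold mean
  apply mul_le_mul_of_nonneg_left _ (by positivity)
  apply intervalIntegral.integral_mono_on (by linarith [pi_pos]) (hf.intervalIntegrable _ _)
    (hg.intervalIntegrable _ _)
  intro x hx
  exact h x hx.1 hx.2

lemma mean_odd {f : ℝ → ℝ} (h : ∀ t, f (-t) = - f t) : mean f = 0 := by
  have h1 : (∫ t in (-π)..π, f (-t)) = ∫ t in (-π)..π, f t := by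
    rw [intervalIntegral.integral_comp_neg]; simp
  simp only [h, intervalIntegral.integral_neg] at h1
  unfold mean
  rw [show (∫ t in (-π)..π, f t) = 0 by linarith, mul_zero]

lemma mean_sum {ι : Type*} (s : Finset ι) (f : ι → ℝ → ℝ) (hf : ∀ i ∈ s, Continuous (f i)) :
    mean (fun t => ∑ i ∈ s, f i t) = ∑ i ∈ s, mean (f i) := by
  unfold mean
  rw [intervalIntegral.integral_finsetSum, Finset.mul_sum]
  exact fun i hi => (hf i hi).intervalIntegrable _ _

lemma mean_cos (p : ℤ) : mean (fun t => cos (p * t)) = if p = 0 then 1 else 0 := by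
  split_ifs with h
  · subst h
    unfold mean
    have := pi_pos
    simp
    field_simp
    ring
  · unfold mean
    have hp : (p : ℝ) ≠ 0 := by exact_mod_cast h
    rw [intervalIntegral.integral_comp_mul_left (fun t => cos t) hp, integral_cos]
    simp [sin_int_mul_pi]

lemma mean_cos_cos (p q : ℤ) : mean (fun t => cos (p * t) * cos (q * t)) =
    ((if p = q then 1 else 0) + (if p = - q then 1 else 0)) / 2 := by
  have h : (fun t : ℝ => cos (p * t) * cos (q * t)) =
      fun t => (1/2) * (cos ((p - q : ℤ) * t) + cos ((p + q : ℤ) * t)) := by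
    funext t
    push_cast
    rw [sub_mul, add_mul, cos_sub, cos_add]; ring
  rw [h, mean_mul, mean_add (by fun_prop) (by fun_prop), mean_cos, mean_cos]
  simp only [sub_eq_zero, add_eq_zero_iff_eq_neg]
  ring

lemma Q_coef (a : ℕ → ℝ) (N l : ℕ) : mean (fun t => Q a N t * cos (l * t)) =
    ∑ k ∈ Finset.range (N - l), a k * a (k + l) := by
  have h : (fun t => Q a N t * cos (l * t)) = fun t => ∑ j ∈ Finset.range N, ∑ k ∈ Finset.range N,
      (a j * a k) * (cos (((j : ℤ) - k : ℤ) * t) * cos ((l : ℤ) * t)) := by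
    funext t
    simp only [Q, Finset.sum_mul]
    refine Finset.sum_congr rfl fun j _ => Finset.sum_congr rfl fun k _ => ?_
    push_cast; ring
  rw [h, mean_sum _ _ (fun i _ => by fun_prop)]
  have h1 : ∀ j ∈ Finset.range N, mean (fun t => ∑ k ∈ Finset.range N,
      (a j * a k) * (cos (((j : ℤ) - k : ℤ) * t) * cos ((l : ℤ) * t))) =
      ∑ k ∈ Finset.range N, ((if j = k + l then a j * a k else 0) / 2
        + (if k = j + l then a j * a k else 0) / 2) := by
    intro j _
    rw [mean_sum _ _ (fun i _ => by fun_prop)]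
    refine Finset.sum_congr rfl fun k _ => ?_
    rw [mean_mul, mean_cos_cos]
    have e1 : ((j : ℤ) - k = l) ↔ j = k + l := by omega
    have e2 : ((j : ℤ) - k = -l) ↔ k = j + l := by omega
    simp only [e1, e2]
    split_ifs <;> ring
  rw [Finset.sum_congr rfl h1]
  simp only [Finset.sum_add_distrib]
  have h2 : ∀ k, k ∈ Finset.range (N - l) ↔ k ∈ (Finset.range N).filter (fun k => k + l < N) := by
    intro k; simp; omega
  have h3 : Finset.range (N - l) = (Finset.range N).filter (fun k => k + l < N) := by
    ext k; exact h2 k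
  rw [Finset.sum_comm]
  have h4 : ∀ k ∈ Finset.range N, (∑ j ∈ Finset.range N, (if j = k + l then a j * a k else 0) / 2)
      = (if k + l < N then a k * a (k + l) else 0) / 2 := by
    intro k _
    rw [← Finset.sum_div, Finset.sum_ite_eq']
    simp [mul_comm]
  have h5 : ∀ j ∈ Finset.range N, (∑ k ∈ Finset.range N, (if k = j + l then a j * a k else 0) / 2)
      = (if j + l < N then a j * a (j + l) else 0) / 2 := by
    intro k _
    rw [← Finset.sum_div, Finset.sum_ite_eq']
    simp
  rw [Finset.sum_congr rfl h4, Finset.sum_congr rfl h5, h3, Finset.sum_filter, ← Finset.sum_add_distrib]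
  exact Finset.sum_congr rfl fun k _ => by ring

lemma C_cos {K : ℝ → ℝ} (hK : Continuous K) (l : ℕ) : C K (fun x => cos (l * x)) =
    (mean (fun t => K t * cos (l * t))) • (fun x : ℝ => cos (l * x)) +
    (mean (fun t => K t * sin (l * t))) • (fun x : ℝ => sin (l * x)) := by
  funext x
  have h : C K (fun x => cos (l * x)) x = mean (fun t => cos (l * x) * (K t * cos (l * t)) +
      sin (l * x) * (K t * sin (l * t))) := by
    unfold C mean
    congr 2; funext t
    simp only [mul_sub, cos_sub]; ring
  rw [h, mean_add (by fun_prop) (by fun_prop), mean_mul, mean_mul]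
  simp; ring

lemma C_sin {K : ℝ → ℝ} (hK : Continuous K) (l : ℕ) : C K (fun x => sin (l * x)) =
    (mean (fun t => K t * cos (l * t))) • (fun x : ℝ => sin (l * x)) -
    (mean (fun t => K t * sin (l * t))) • (fun x : ℝ => cos (l * x)) := by
  funext x
  have h : C K (fun x => sin (l * x)) x = mean (fun t => sin (l * x) * (K t * cos (l * t)) +
      (-cos (l * x)) * (K t * sin (l * t))) := by
    unfold C mean
    congr 2; funext t
    simp only [mul_sub, sin_sub]; ring
  rw [h, mean_add (by fun_prop) (by fun_prop), mean_mul, mean_mul]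
  simp; ring

/-- Fejér kernel -/
noncomputable def Fej (N : ℕ) : ℝ → ℝ := fun t => (1 / (N : ℝ)) * Q (fun _ => 1) N t

lemma Fej_nonneg (N : ℕ) (t : ℝ) : 0 ≤ Fej N t := mul_nonneg (by positivity) (Q_nonneg _ _ _)
lemma Fej_cont (N : ℕ) : Continuous (Fej N) := (Q_cont _ _).const_mul _
lemma Fej_even (N : ℕ) (t : ℝ) : Fej N (-t) = Fej N t := by simp [Fej, Q_even]
lemma Fej_mem (n : ℕ) : Fej (n + 1) ∈ TP n := Submodule.smul_mem _ (1 / ((n + 1 : ℕ) : ℝ)) (Q_mem _ n)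
lemma Fej_coef (N l : ℕ) : mean (fun t => Fej N t * cos (l * t)) = ((N - l : ℕ) : ℝ) / N := by
  unfold Fej
  simp only [mul_assoc]
  rw [mean_mul, Q_coef]
  simp
  ring
lemma Fej_mean (N : ℕ) (hN : 1 ≤ N) : mean (Fej N) = 1 := by
  have := Fej_coef N 0
  simp at this
  rw [this, div_self]
  positivity

/-- Existence of de la Vallee-Poussin kernels. -/
lemma VP_exists (m : ℕ) : ∃ v : ℝ → ℝ, v ∈ TP (2 * m) ∧ mean (fun t => |v t|) ≤ 3 ∧
    ∀ p ∈ TP m, C v p = p := by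
  have key : ∀ v : ℝ → ℝ, Continuous v → (∀ t, v (-t) = v t) →
      (∀ l : ℕ, l ≤ m → mean (fun t => v t * cos (l * t)) = 1) → ∀ p ∈ TP m, C v p = p := by
    intro v hv hev hl p hp
    have hs : ∀ l : ℕ, mean (fun t => v t * sin (l * t)) = 0 := by
      intro l
      apply mean_odd
      intro t; simp [hev]
    refine TP_ind (n := m) (p := fun p => C v p = p) ?_ ?_ ?_ ?_ ?_ hp
    · intro k hk
      rw [C_cos hv, hl k hk, hs]; simp
    · intro k hk
      rw [C_sin hv, hl k hk, hs]; simp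
    · funext x; simp [C]
    · intro f g hf hg h1 h2
      rw [C_add hv (TP_le_E _ hf).1 (TP_le_E _ hg).1, h1, h2]
    · intro c f _ h1
      rw [C_smul, h1]
  rcases Nat.eq_zero_or_pos m with rfl | hm
  · refine ⟨Fej 1, Fej_mem 0, ?_, key _ (Fej_cont _) (Fej_even _) ?_⟩
    · simp only [abs_of_nonneg (Fej_nonneg _ _)]
      have := Fej_mean 1 le_rfl
      unfold mean at *
      rw [this]; norm_num
    · intro l hl
      rw [Fej_coef]
      obtain rfl : l = 0 := by omega
      simp
  · refine ⟨(2:ℝ) • Fej (2 * m) + (-1 : ℝ) • Fej m, ?_, ?_, key _ ?_ ?_ ?_⟩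
    · apply Submodule.add_mem
      · apply Submodule.smul_mem
        have := Fej_mem (2 * m - 1)
        rw [show 2 * m - 1 + 1 = 2 * m by omega] at this
        exact TP_mono (by omega) this
      · apply Submodule.smul_mem
        have := Fej_mem (m - 1)
        rw [show m - 1 + 1 = m by omega] at this
        exact TP_mono (by omega) this
    · have c1 := Fej_cont (2 * m)
      have c2 := Fej_cont m
      have : mean (fun t => |((2:ℝ) • Fej (2 * m) + (-1 : ℝ) • Fej m) t|) ≤
          mean (fun t => 2 * Fej (2 * m) t + Fej m t) := by
        apply mean_mono
        · simp only [Pi.add_apply, Pi.smul_apply, smul_eq_mul]; fun_prop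
        · fun_prop
        · intro t _ _
          have h1 := Fej_nonneg (2 * m) t
          have h2 := Fej_nonneg m t
          simp only [Pi.add_apply, Pi.smul_apply, smul_eq_mul]
          rw [abs_le]; constructor <;> linarith
      refine this.trans ?_
      rw [mean_add (by fun_prop) c2, mean_mul, Fej_mean _ (by omega), Fej_mean _ hm]
      norm_num
    · exact ((Fej_cont _).const_smul _).add ((Fej_cont _).const_smul _)
    · intro t; simp [Fej_even]
    · intro l hl
      have c1 := Fej_cont (2 * m)
      have c2 := Fej_cont m
      have : (fun t => ((2:ℝ) • Fej (2 * m) + (-1 : ℝ) • Fej m) t * cos (l * t)) =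
        fun t => 2 * (Fej (2 * m) t * cos (l * t)) + (-1) * (Fej m t * cos (l * t)) := by
        funext t
        simp only [Pi.add_apply, Pi.smul_apply, smul_eq_mul]; ring
      rw [this, mean_add (by fun_prop) (by fun_prop), mean_mul, mean_mul, Fej_coef, Fej_coef,
        Nat.cast_sub hl, Nat.cast_sub (by omega)]
      have : (m : ℝ) ≠ 0 := by positivity
      push_cast
      field_simp
      ring

/-- Bernstein inequality (with constant 2) -/
lemma bernstein {N : ℕ} (hN : 1 ≤ N) {p : ℝ → ℝ} (hp : p ∈ TP N) {M : ℝ} (hM : Bd p M) :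
    Bd (deriv p) (2 * N * M) := by
  set G : ℝ → ℝ := fun t => 2 * N * (Fej N t * sin (N * t)) with hG
  have c1 := Fej_cont N
  have hGc : Continuous G := by fun_prop
  have hN' : (N : ℝ) ≠ 0 := by positivity
  have h1 : ∀ l : ℕ, mean (fun t => G t * cos (l * t)) = 0 := by
    intro l
    apply mean_odd
    intro t; simp [hG, Fej_even]
  have h2 : ∀ l : ℕ, l ≤ N → mean (fun t => G t * sin (l * t)) = l := by
    intro l hl
    have : (fun t => G t * sin (l * t)) = fun t => N * (Fej N t * cos ((N - l : ℕ) * t)) +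
        (-N) * (Fej N t * cos ((N + l : ℕ) * t)) := by
      funext t
      rw [Nat.cast_sub hl]; push_cast
      rw [sub_mul, add_mul, cos_sub, cos_add]; simp only [hG]; ring
    rw [this, mean_add (by fun_prop) (by fun_prop), mean_mul, mean_mul, Fej_coef, Fej_coef,
      show N - (N - l) = l by omega, show N - (N + l) = 0 by omega]
    field_simp
    simp
  have h3 : C G p = - deriv p := by
    refine TP_ind (n := N) (p := fun p => C G p = - deriv p) ?_ ?_ ?_ ?_ ?_ hp
    · intro k hk
      rw [C_cos hGc, h1, h2 k hk]
      funext x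
      have h : HasDerivAt (fun x : ℝ => cos (k * x)) (-sin (k * x) * (k * 1)) x :=
        ((hasDerivAt_id x).const_mul (k:ℝ)).cos
      simp only [Pi.neg_apply]
      rw [h.deriv]; simp; ring
    · intro k hk
      rw [C_sin hGc, h1, h2 k hk]
      funext x
      have h : HasDerivAt (fun x : ℝ => sin (k * x)) (cos (k * x) * (k * 1)) x :=
        ((hasDerivAt_id x).const_mul (k:ℝ)).sin
      simp only [Pi.neg_apply]
      rw [h.deriv]; simp; ring
    · funext x; simp [C]
    · intro f g hf hg e1 e2
      rw [C_add hGc (TP_le_E _ hf).1 (TP_le_E _ hg).1, e1, e2]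
      funext x
      simp only [Pi.add_apply, Pi.neg_apply]
      rw [deriv_add ((TP_deriv hf).1 x) ((TP_deriv hg).1 x)]; ring
    · intro c f hf e1
      rw [C_smul, e1]
      funext x
      simp only [Pi.smul_apply, Pi.neg_apply]
      rw [deriv_const_smul c ((TP_deriv hf).1 x)]; simp
  have h4 : (1 / (2 * π)) * ∫ t in (-π)..π, |G t| ≤ 2 * N := by
    have : mean (fun t => |G t|) ≤ mean (fun t => 2 * N * Fej N t) := by
      apply mean_mono (by fun_prop) (by fun_prop)
      intro t _ _
      simp only [hG]
      rw [abs_mul, abs_of_nonneg (by positivity : (0:ℝ) ≤ 2 * N), abs_mul, abs_of_nonneg (Fej_nonneg N t)]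
      apply mul_le_mul_of_nonneg_left _ (by positivity)
      exact mul_le_of_le_one_right (Fej_nonneg N t) (abs_sin_le_one _)
    rw [mean_mul, Fej_mean N hN, mul_one] at this
    exact this
  have h5 := C_bd hGc (TP_le_E _ hp).1 h4 hM
  rw [h3] at h5
  intro x
  simpa using h5 x

/-- Fejér–Korovkin kernel -/
lemma FK_exists (m : ℕ) : ∃ K : ℝ → ℝ, K ∈ TP m ∧ (∀ t, 0 ≤ K t) ∧ mean K = 1 ∧
    mean (fun t => K t * (1 - cos t)) = 1 - cos (π / (m + 2)) := by
  set θ : ℝ := π / (m + 2) with hθ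
  have hθ0 : 0 < θ := by positivity
  set s : ℕ → ℝ := fun i => sin (i * θ) with hs
  set a : ℕ → ℝ := fun j => s (j + 1) with ha
  set A : ℝ := ∑ k ∈ Finset.range (m + 1), a k * a k with hA
  have h0 : mean (Q a (m + 1)) = A := by
    have := Q_coef a (m + 1) 0
    simpa using this
  have h1 : mean (fun t => Q a (m + 1) t * cos t) = cos θ * A := by
    have := Q_coef a (m + 1) 1
    simp only [Nat.cast_one, one_mul, Nat.add_sub_cancel] at this
    rw [this]
    have e : ∀ j : ℕ, s j + s (j + 2) = 2 * cos θ * a j := by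
      intro j
      simp only [hs, ha]
      push_cast
      rw [show ((j:ℝ)) * θ = (j + 1) * θ - θ by ring, show ((j:ℝ) + 2) * θ = (j + 1) * θ + θ by ring,
        sin_sub, sin_add]; ring
    have e2 : 2 * cos θ * A = ∑ j ∈ Finset.range (m + 1), s (j + 1) * s j +
        ∑ j ∈ Finset.range (m + 1), s (j + 1) * s (j + 2) := by
      rw [hA, Finset.mul_sum, ← Finset.sum_add_distrib]
      refine Finset.sum_congr rfl fun j _ => ?_
      rw [← mul_add, e]; simp only [ha]; ring
    rw [Finset.sum_range_succ', Finset.sum_range_succ (fun j => s (j + 1) * s (j + 2))] at e2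
    have e3 : s 0 = 0 := by simp [hs]
    have e4 : s (m + 2) = 0 := by
      simp only [hs, hθ]
      push_cast
      rw [mul_div_cancel₀]
      · exact sin_pi
      · positivity
    rw [e3, e4] at e2
    have e5 : ∑ j ∈ Finset.range m, s (j + 1 + 1) * s (j + 1) = ∑ k ∈ Finset.range m, a k * a (k + 1) :=
      Finset.sum_congr rfl fun j _ => mul_comm _ _
    have e6 : ∑ j ∈ Finset.range m, s (j + 1) * s (j + 2) = ∑ k ∈ Finset.range m, a k * a (k + 1) := rfl
    rw [e5, e6] at e2
    linarith
  have hApos : 0 < A := by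
    have hmem : 0 ∈ Finset.range (m + 1) := by simp
    have h2 := Finset.single_le_sum (f := fun k => a k * a k) (fun i _ => mul_self_nonneg _) hmem
    have h3 : 0 < a 0 := by
      simp only [ha, hs]
      push_cast
      norm_num
      apply sin_pos_of_pos_of_lt_pi hθ0
      rw [hθ, div_lt_iff₀ (by positivity)]
      nlinarith [pi_pos, (Nat.cast_nonneg m : (0:ℝ) ≤ m)]
    exact lt_of_lt_of_le (mul_pos h3 h3) h2
  have hc := Q_cont a (m + 1)
  refine ⟨fun t => (1 / A) * Q a (m + 1) t, Submodule.smul_mem _ (1 / A) (Q_mem a m), ?_, ?_, ?_⟩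
  · intro t
    exact mul_nonneg (by positivity) (Q_nonneg _ _ _)
  · rw [mean_mul, h0]; field_simp
  · have : (fun t => 1 / A * Q a (m + 1) t * (1 - cos t)) = fun t => (1 / A) * Q a (m + 1) t +
      (-1 / A) * (Q a (m + 1) t * cos t) := by funext t; ring
    rw [this, mean_add (by fun_prop) (by fun_prop), mean_mul, mean_mul, h0, h1]
    field_simp
    ring

lemma sq_le_cos {t : ℝ} (h1 : -π ≤ t) (h2 : t ≤ π) : t ^ 2 ≤ π ^ 2 / 2 * (1 - cos t) := by
  have h := Real.cos_le_one_sub_mul_cos_sq (x := t) (abs_le.2 ⟨h1, h2⟩)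
  have h3 : 2 / π ^ 2 * t ^ 2 ≤ 1 - cos t := by linarith
  calc t ^ 2 = π ^ 2 / 2 * (2 / π ^ 2 * t ^ 2) := by field_simp
    _ ≤ _ := by gcongr

lemma jackson1 (m : ℕ) : ∃ K : ℝ → ℝ, K ∈ TP m ∧ ∀ u u' : ℝ → ℝ, u ∈ E → u' ∈ E →
    (∀ x, HasDerivAt u (u' x) x) → ∀ M, Bd u' M → Bd (u - C K u) (7 / (m + 1) * M) := by
  obtain ⟨K, hKm, hK0, hK1, hK2⟩ := FK_exists m
  refine ⟨K, hKm, ?_⟩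
  intro u u' hu hu' hd M hM x
  have hKc : Continuous K := (TP_le_E _ hKm).1
  have huc : Continuous u := hu.1
  have hM0 := hM.nonneg
  set θ : ℝ := π / (m + 2) with hθ
  have hθ0 : 0 < θ := by positivity
  have hlip : ∀ y z, |u y - u z| ≤ M * |y - z| := by
    intro y z
    have := Convex.norm_image_sub_le_of_norm_hasDerivWithin_le (f := u) (f' := u') (s := Set.univ)
      (x := z) (y := y) (C := M) (fun x _ => (hd x).hasDerivWithinAt) (fun x _ => hM x) convex_univ
      (Set.mem_univ _) (Set.mem_univ _)
    simpa using this
  have e1 : (u - C K u) x = mean (fun t => K t * (u x - u (x - t))) := by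
    have : (fun t => K t * (u x - u (x - t))) = fun t => u x * K t + (-1) * (K t * u (x - t)) := by
      funext t; ring
    rw [this, mean_add (by fun_prop) (by fun_prop), mean_mul, mean_mul, hK1]
    simp [C, mean]; ring
  have e2 : |mean (fun t => K t * (u x - u (x - t)))| ≤ mean (fun t => |K t * (u x - u (x - t))|) := by
    unfold mean
    rw [abs_mul, abs_of_pos (by positivity : 0 < 1 / (2 * π))]
    gcongr
    exact intervalIntegral.abs_integral_le_integral_abs (by linarith [pi_pos])
  rw [e1]
  refine e2.trans ?_
  have e3 : mean (fun t => |K t * (u x - u (x - t))|) ≤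
      mean (fun t => (M * θ / 2) * K t + (M * π ^ 2 / (4 * θ)) * (K t * (1 - cos t))) := by
    apply mean_mono (by fun_prop) (by fun_prop)
    intro t h1 h2
    rw [abs_mul, abs_of_nonneg (hK0 t)]
    have h3 := hlip x (x - t)
    rw [sub_sub_cancel] at h3
    have h4 : |t| ≤ θ / 2 + π ^ 2 / (4 * θ) * (1 - cos t) := by
      have h5 := sq_le_cos h1 h2
      have h6 : |t| ≤ θ / 2 + t ^ 2 / (2 * θ) := by
        rw [← sq_abs t]
        have : θ / 2 + |t| ^ 2 / (2 * θ) - |t| = (θ - |t|) ^ 2 / (2 * θ) := by field_simp; ring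
        have h7 : 0 ≤ (θ - |t|) ^ 2 / (2 * θ) := by positivity
        linarith
      have h8 : t ^ 2 / (2 * θ) ≤ π ^ 2 / 2 * (1 - cos t) / (2 * θ) := by gcongr
      have h9 : π ^ 2 / 2 * (1 - cos t) / (2 * θ) = π ^ 2 / (4 * θ) * (1 - cos t) := by
        field_simp; ring
      linarith
    calc K t * |u x - u (x - t)| ≤ K t * (M * (θ / 2 + π ^ 2 / (4 * θ) * (1 - cos t))) := by
          apply mul_le_mul_of_nonneg_left _ (hK0 t)
          exact h3.trans (mul_le_mul_of_nonneg_left h4 hM0)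
      _ = _ := by ring
  refine e3.trans ?_
  rw [mean_add (by fun_prop) (by fun_prop), mean_mul, mean_mul, hK1, hK2]
  have h1 : 1 - cos θ ≤ θ ^ 2 / 2 := by linarith [one_sub_sq_div_two_le_cos (x := θ)]
  have h2 : π < 3.15 := pi_lt_d2
  have h3 : 0 < π := pi_pos
  calc M * θ / 2 * 1 + M * π ^ 2 / (4 * θ) * (1 - cos θ)
      ≤ M * θ / 2 * 1 + M * π ^ 2 / (4 * θ) * (θ ^ 2 / 2) := by gcongr
    _ = M * θ * (1 / 2 + π ^ 2 / 8) := by field_simp; ring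
    _ ≤ M * θ * 2 := by gcongr; nlinarith
    _ = M * (2 * π / (m + 2)) := by rw [hθ]; ring
    _ ≤ M * (7 / (m + 1)) := by
        apply mul_le_mul_of_nonneg_left _ hM0
        apply div_le_div₀ <;> linarith [(Nat.cast_nonneg m : (0:ℝ) ≤ m)]
    _ = _ := by ring

end Trig

namespace Trig

/-- consecutive derivatives -/
def IsChain (r : ℕ) (U : ℕ → ℝ → ℝ) : Prop :=
  (∀ i, i ≤ r → U i ∈ E) ∧ ∀ i, i < r → ∀ x, HasDerivAt (U i) (U (i + 1) x) x

lemma C_mem_E {m : ℕ} {K f : ℝ → ℝ} (hK : K ∈ TP m) (hf : f ∈ E) : C K f ∈ E :=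
  TP_le_E m (C_mem hK hf)

lemma IsChain.conv {r m : ℕ} {U : ℕ → ℝ → ℝ} (hU : IsChain r U) {K : ℝ → ℝ} (hK : K ∈ TP m) :
    IsChain r (fun i => C K (U i)) :=
  ⟨fun i hi => C_mem_E hK (hU.1 i hi), fun i hi x =>
    C_deriv (TP_le_E _ hK).1 (hU.2 i hi) (hU.1 (i + 1) hi) x⟩

lemma jackson_r (m r : ℕ) : ∀ U : ℕ → ℝ → ℝ, IsChain r U → ∀ M, Bd (U r) M →
    ∃ P ∈ TP m, Bd (U 0 - P) ((7 / (m + 1)) ^ r * M) := by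
  obtain ⟨K, hK, hJ⟩ := jackson1 m
  induction r with
  | zero =>
    intro U hU M hM
    exact ⟨0, Submodule.zero_mem _, by simpa using hM⟩
  | succ r ih =>
    intro U hU M hM
    have hc := hU.conv hK
    obtain ⟨P, hP, hB⟩ := ih (fun i => U i - C K (U i))
      ⟨fun i hi => Submodule.sub_mem _ (hU.1 i (by omega)) (hc.1 i (by omega)),
       fun i hi x => (hU.2 i (by omega) x).sub (hc.2 i (by omega) x)⟩ (7 / (m + 1) * M)
       (hJ _ _ (hU.1 r (by omega)) (hU.1 (r + 1) le_rfl) (hU.2 r (by omega)) M hM)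
    refine ⟨C K (U 0) + P, Submodule.add_mem _ (C_mem hK (hU.1 0 (by omega))) hP, ?_⟩
    have e : U 0 - (C K (U 0) + P) = U 0 - C K (U 0) - P := by abel
    rw [e]
    refine hB.mono (le_of_eq ?_)
    ring

lemma fwd_mem {t : ℝ} {f : ℝ → ℝ} (hf : f ∈ E) : fwdDiff t f ∈ E := by
  refine ⟨?_, ?_⟩
  · have := hf.1
    unfold fwdDiff; fun_prop
  · intro x
    unfold fwdDiff
    rw [show x + 2 * π + t = x + t + 2 * π by ring, hf.2, hf.2]

lemma fwd_iter_mem {t : ℝ} {f : ℝ → ℝ} (hf : f ∈ E) (j : ℕ) : (fwdDiff t)^[j] f ∈ E := by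
  induction j with
  | zero => exact hf
  | succ j ih => rw [Function.iterate_succ_apply']; exact fwd_mem ih

lemma fwd_deriv {t : ℝ} {f f' : ℝ → ℝ} (h : ∀ x, HasDerivAt f (f' x) x) (x : ℝ) :
    HasDerivAt (fwdDiff t f) (fwdDiff t f' x) x := by
  unfold fwdDiff
  exact ((h (x + t)).comp_add_const x t).sub (h x)

lemma fwd_iter_deriv {t : ℝ} {f f' : ℝ → ℝ} (h : ∀ x, HasDerivAt f (f' x) x) (j : ℕ) (x : ℝ) :
    HasDerivAt ((fwdDiff t)^[j] f) ((fwdDiff t)^[j] f' x) x := by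
  induction j generalizing x with
  | zero => exact h x
  | succ j ih =>
    rw [Function.iterate_succ_apply', Function.iterate_succ_apply']; exact fwd_deriv ih x

lemma fwd_iter_eq (r : ℕ) (t : ℝ) (f : ℝ → ℝ) (x : ℝ) : (fwdDiff t)^[r] f x =
    ∑ k ∈ Finset.range (r + 1), (-1 : ℝ) ^ (r - k) * (r.choose k : ℝ) * f (x + k * t) := by
  rw [fwdDiff_iter_eq_sum_shift]
  refine Finset.sum_congr rfl fun k _ => ?_
  simp

lemma fwd_bd {t M : ℝ} {f : ℝ → ℝ} (h : Bd f M) : Bd (fwdDiff t f) (2 * M) := by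
  intro x
  unfold fwdDiff
  have := abs_sub (f (x + t)) (f x)
  linarith [h (x + t), h x]

lemma fwd_iter_bd {t M : ℝ} {f : ℝ → ℝ} (h : Bd f M) (j : ℕ) :
    Bd ((fwdDiff t)^[j] f) (2 ^ j * M) := by
  induction j with
  | zero => simpa using h
  | succ j ih =>
    rw [Function.iterate_succ_apply']
    exact (fwd_bd ih).mono (le_of_eq (by ring))

lemma fwd_smooth {t : ℝ} (ht : 0 ≤ t) (r : ℕ) : ∀ U : ℕ → ℝ → ℝ, IsChain r U → ∀ M, Bd (U r) M →
    Bd ((fwdDiff t)^[r] (U 0)) (t ^ r * M) := by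
  induction r with
  | zero => intro U hU M hM; simpa using hM
  | succ r ih =>
    intro U hU M hM
    rw [Function.iterate_succ_apply]
    have := ih (fun i => fwdDiff t (U i)) ⟨fun i hi => fwd_mem (hU.1 i (by omega)),
      fun i hi x => fwd_deriv (hU.2 i (by omega)) x⟩ (t * M) ?_
    · exact this.mono (le_of_eq (by ring))
    · intro x
      have := Convex.norm_image_sub_le_of_norm_hasDerivWithin_le (f := U r) (f' := U (r + 1))
        (s := Set.univ) (x := x) (y := x + t) (C := M)
        (fun x _ => (hU.2 r (by omega) x).hasDerivWithinAt) (fun x _ => hM x) convex_univ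
        (Set.mem_univ _) (Set.mem_univ _)
      simp only [add_sub_cancel_left, Real.norm_eq_abs, abs_of_nonneg ht] at this
      unfold fwdDiff
      linarith

/-- Steklov mean -/
noncomputable def avg (a : ℝ) (f : ℝ → ℝ) : ℝ → ℝ := fun x => ∫ s in (0:ℝ)..1, f (x + a * s)

lemma avg_mem {a : ℝ} {f : ℝ → ℝ} (hf : f ∈ E) : avg a f ∈ E := by
  have hc := hf.1
  refine ⟨?_, ?_⟩
  · unfold avg
    apply intervalIntegral.continuous_parametric_intervalIntegral_of_continuous'
    unfold Function.uncurry
    fun_prop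
  · intro x
    unfold avg
    congr 1; funext s
    rw [show x + 2 * π + a * s = x + a * s + 2 * π by ring, hf.2]

lemma avg_iter_mem {a : ℝ} {f : ℝ → ℝ} (hf : f ∈ E) (j : ℕ) : (avg a)^[j] f ∈ E := by
  induction j with
  | zero => exact hf
  | succ j ih => rw [Function.iterate_succ_apply']; exact avg_mem ih

lemma avg_deriv {a : ℝ} (ha : a ≠ 0) {f : ℝ → ℝ} (hf : f ∈ E) (x : ℝ) :
    HasDerivAt (avg a f) ((a⁻¹ • fwdDiff a f) x) x := by
  have hc := hf.1
  have e : avg a f = fun x => a⁻¹ * ((∫ s in (0:ℝ)..(x + a), f s) - ∫ s in (0:ℝ)..x, f s) := by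
    funext x
    unfold avg
    rw [intervalIntegral.integral_comp_add_mul (fun s => f s) ha,
      intervalIntegral.integral_interval_sub_left (hc.intervalIntegrable _ _)
        (hc.intervalIntegrable _ _)]
    simp
  rw [e]
  simp only [Pi.smul_apply, smul_eq_mul, fwdDiff]
  apply HasDerivAt.const_mul
  have h : ∀ y, HasDerivAt (fun y => ∫ s in (0:ℝ)..y, f s) (f y) y := fun y =>
    intervalIntegral.integral_hasDerivAt_right (hc.intervalIntegrable _ _)
      (hc.stronglyMeasurableAtFilter _ _) hc.continuousAt
  exact ((h (x + a)).comp_add_const x a).sub (h x)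

lemma avg_chain {a : ℝ} (ha : a ≠ 0) {f : ℝ → ℝ} (hf : f ∈ E) (r : ℕ) :
    IsChain r (fun i => (a⁻¹ ^ i) • (fwdDiff a)^[i] ((avg a)^[r - i] f)) := by
  refine ⟨fun i hi => Submodule.smul_mem _ _ (fwd_iter_mem (avg_iter_mem hf _) _), ?_⟩
  intro i hi x
  have e : r - i = (r - (i + 1)) + 1 := by omega
  simp only [e, Function.iterate_succ_apply']
  set g := (avg a)^[r - (i + 1)] f with hg
  have hgE : g ∈ E := avg_iter_mem hf _
  have h := (fwd_iter_deriv (t := a) (avg_deriv ha hgE) i x).const_smul (a⁻¹ ^ i)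
  have e2 : a⁻¹ ^ i • (fwdDiff a)^[i] (a⁻¹ • fwdDiff a g) x =
      (a⁻¹ ^ (i + 1) • fwdDiff a ((fwdDiff a)^[i] g)) x := by
    rw [fwdDiff_iter_const_smul, ← Function.iterate_succ_apply' (fwdDiff a),
      Function.iterate_succ_apply]
    simp only [Pi.smul_apply, smul_eq_mul]
    ring
  rw [e2] at h
  exact h

lemma avg_diff {r : ℕ} (c : ℕ → ℝ) {a b M : ℝ} (ha : 0 ≤ a) {f : ℝ → ℝ} (hf : f ∈ E)
    (h : ∀ s, 0 ≤ s → s ≤ b → ∀ x, |∑ k ∈ Finset.range (r + 1), c k * f (x + k * s)| ≤ M) (j : ℕ) :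
    ∀ s, 0 ≤ s → s + j * a ≤ b → ∀ x,
      |∑ k ∈ Finset.range (r + 1), c k * (avg (k * a))^[j] f (x + k * s)| ≤ M := by
  induction j with
  | zero => intro s hs hb x; simpa using h s hs (by simpa using hb) x
  | succ j ih =>
    intro s hs hb x
    simp only [Function.iterate_succ_apply']
    have e : ∑ k ∈ Finset.range (r + 1), c k * avg (k * a) ((avg (k * a))^[j] f) (x + k * s) =
        ∫ σ in (0:ℝ)..1, ∑ k ∈ Finset.range (r + 1), c k * (avg (k * a))^[j] f (x + k * (s + a * σ)) := by
      rw [intervalIntegral.integral_finsetSum]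
      · refine Finset.sum_congr rfl fun k _ => ?_
        rw [intervalIntegral.integral_const_mul]
        simp only [avg]
        congr 2; funext σ; ring_nf
      · intro k _
        have := (avg_iter_mem (a := k * a) hf j).1
        exact Continuous.intervalIntegrable (by fun_prop) _ _
    rw [e]
    have := intervalIntegral.norm_integral_le_of_norm_le_const (a := (0:ℝ)) (b := 1) (C := M)
      (f := fun σ => ∑ k ∈ Finset.range (r + 1), c k * (avg (k * a))^[j] f (x + k * (s + a * σ))) ?_
    · simpa using this
    · intro σ hσ
      rw [Set.uIoc_of_le zero_le_one] at hσ
      have h1 : 0 ≤ a * σ := mul_nonneg ha hσ.1.le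
      have h2 : a * σ ≤ a := mul_le_of_le_one_right ha hσ.2
      apply ih (s + a * σ) (by linarith)
      push_cast at hb
      linarith

lemma avg_zero_iter (f : ℝ → ℝ) (j : ℕ) : (avg 0)^[j] f = f := by
  induction j with
  | zero => rfl
  | succ j ih => rw [Function.iterate_succ_apply', ih]; funext x; simp [avg]

lemma IsChain.sum {r : ℕ} {ι : Type*} (s : Finset ι) (c : ι → ℝ) (U : ι → ℕ → ℝ → ℝ)
    (h : ∀ i ∈ s, IsChain r (U i)) : IsChain r (fun j => ∑ i ∈ s, c i • U i j) := by
  refine ⟨fun j hj => Submodule.sum_mem _ fun i hi => Submodule.smul_mem _ _ ((h i hi).1 j hj), ?_⟩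
  intro j hj x
  simp only [Finset.sum_apply, Pi.smul_apply]
  exact HasDerivAt.sum fun i hi => ((h i hi).2 j hj x).const_smul (c i)

lemma kfun (r : ℕ) (hr : 1 ≤ r) {f : ℝ → ℝ} (hf : f ∈ E) {h Ω : ℝ} (hh : 0 < h)
    (hΩ : ∀ t, 0 ≤ t → t ≤ h → Bd ((fwdDiff t)^[r] f) Ω) :
    ∃ U, IsChain r U ∧ Bd (f - U 0) Ω ∧ Bd (U r) ((2 * r / h) ^ r * Ω) := by
  have hΩ0 : 0 ≤ Ω := (hΩ 0 le_rfl hh.le).nonneg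
  set c : ℕ → ℝ := fun k => (-1 : ℝ) ^ (r - k) * (r.choose k : ℝ) with hc
  set a : ℝ := h / r with ha
  have hr0 : (0:ℝ) < r := by exact_mod_cast hr
  have ha0 : 0 < a := by positivity
  set Uk : ℕ → ℕ → ℝ → ℝ := fun k i =>
    ((((k + 1 : ℕ) : ℝ) * a)⁻¹ ^ i) • (fwdDiff (((k + 1 : ℕ) : ℝ) * a))^[i] ((avg (((k + 1 : ℕ) : ℝ) * a))^[r - i] f) with hUk
  refine ⟨fun j => ∑ k ∈ Finset.range r, ((-1) ^ (r + 1) * c (k + 1)) • Uk k j, ?_, ?_, ?_⟩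
  · apply IsChain.sum
    intro k _
    exact avg_chain (by positivity) hf r
  · intro x
    have h1 := avg_diff (r := r) c (b := h) ha0.le hf (M := Ω) ?_ r 0 le_rfl (by rw [ha]; field_simp; simp) x
    · rw [Finset.sum_range_succ'] at h1
      have h2 : |(-1 : ℝ) ^ r| = 1 := by simp
      have h3 : (f - ∑ k ∈ Finset.range r, ((-1) ^ (r + 1) * c (k + 1)) • Uk k 0) x = (-1) ^ r *
        (∑ k ∈ Finset.range r, c (k + 1) * (avg (((k + 1 : ℕ) : ℝ) * a))^[r] f (x + ((k + 1 : ℕ) : ℝ) * 0)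
          + c 0 * (avg (((0 : ℕ) : ℝ) * a))^[r] f (x + ((0 : ℕ) : ℝ) * 0)) := by
        have h4 : (-1 : ℝ) ^ r * (-1) ^ r = 1 := by rw [← mul_pow]; simp
        have h5 : c 0 = (-1) ^ r := by simp [hc]
        have h6 : (avg (((0 : ℕ) : ℝ) * a))^[r] f = f := by
          rw [Nat.cast_zero, zero_mul, avg_zero_iter]
        rw [mul_add, h6, h5, ← mul_assoc, h4, Finset.mul_sum]
        simp only [Pi.sub_apply, Finset.sum_apply, Pi.smul_apply, smul_eq_mul, hUk, pow_zero,
          one_mul, Function.iterate_zero, id, Nat.sub_zero, mul_zero, add_zero]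
        rw [sub_eq_add_neg, ← Finset.sum_neg_distrib, add_comm]
        congr 1
        refine Finset.sum_congr rfl fun k _ => ?_
        ring
      rw [h3, abs_mul, h2, one_mul]
      exact h1
    · intro s hs hb x
      have := hΩ s hs hb x
      rw [fwd_iter_eq] at this
      exact this
  · intro x
    simp only [Finset.sum_apply, Pi.smul_apply, smul_eq_mul, hUk, Nat.sub_self, Function.iterate_zero, id]
    refine (Finset.abs_sum_le_sum_abs _ _).trans ?_
    have h1 : ∀ k ∈ Finset.range r, |(-1) ^ (r + 1) * c (k + 1) * ((((k + 1 : ℕ) : ℝ) * a)⁻¹ ^ r *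
        (fwdDiff (((k + 1 : ℕ) : ℝ) * a))^[r] f x)| ≤ (r.choose (k + 1) : ℝ) * (a⁻¹ ^ r * Ω) := by
      intro k hk
      rw [Finset.mem_range] at hk
      have hk1 : (1:ℝ) ≤ ((k + 1 : ℕ) : ℝ) := by exact_mod_cast Nat.le_add_left 1 k
      have hk2 : ((k + 1 : ℕ) : ℝ) ≤ r := by exact_mod_cast hk
      have h2 := hΩ (((k + 1 : ℕ) : ℝ) * a) (by positivity) (by
        rw [ha]; calc _ ≤ (r:ℝ) * (h / r) := by gcongr
          _ = h := by field_simp) x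
      simp only [hc, abs_mul, abs_pow, abs_neg, abs_one, one_pow, one_mul, Nat.abs_cast]
      gcongr
      rw [abs_of_pos (by positivity)]
      gcongr
      exact le_mul_of_one_le_left ha0.le hk1
    refine (Finset.sum_le_sum h1).trans ?_
    rw [← Finset.sum_mul]
    have h3 : ∑ k ∈ Finset.range r, (r.choose (k + 1) : ℝ) ≤ 2 ^ r := by
      have := Nat.sum_range_choose r
      rw [Finset.sum_range_succ'] at this
      have h4 : ∑ k ∈ Finset.range r, r.choose (k + 1) ≤ 2 ^ r := by omega
      exact_mod_cast h4
    calc _ ≤ 2 ^ r * (a⁻¹ ^ r * Ω) := by gcongr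
      _ = _ := by rw [ha, inv_div, ← mul_assoc, ← mul_pow]; ring

end Trig

namespace Trig

lemma max_principle {p p' : ℝ → ℝ} (hp : p ∈ E) (hd : ∀ x, HasDerivAt p (p' x) x) {l M : ℝ}
    (h : Bd (fun x => p x + l * p' x) M) : Bd p M := by
  have hcomp := hp.2.compact_of_continuous (by positivity) hp.1
  have hne : (Set.range p).Nonempty := Set.range_nonempty p
  obtain ⟨_, ⟨x0, rfl⟩, h0⟩ := hcomp.exists_isGreatest hne
  obtain ⟨_, ⟨x1, rfl⟩, h1⟩ := hcomp.exists_isLeast hne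
  have d0 : p' x0 = 0 := by
    refine IsLocalMax.hasDerivAt_eq_zero ?_ (hd x0)
    exact Filter.Eventually.of_forall fun x => h0 ⟨x, rfl⟩
  have d1 : p' x1 = 0 := by
    refine IsLocalMin.hasDerivAt_eq_zero ?_ (hd x1)
    exact Filter.Eventually.of_forall fun x => h1 ⟨x, rfl⟩
  have e0 := h x0
  have e1 := h x1
  simp only [d0, d1, mul_zero, add_zero] at e0 e1
  intro x
  have f0 : p x ≤ p x0 := h0 ⟨x, rfl⟩
  have f1 : p x1 ≤ p x := h1 ⟨x, rfl⟩
  rw [abs_le] at *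
  constructor <;> linarith

instance (N : ℕ) : FiniteDimensional ℝ (TP N) := by
  unfold TP
  apply FiniteDimensional.span_of_finite
  have : {g : ℝ → ℝ | ∃ k : ℕ, k ≤ N ∧ (g = (fun x => cos (k * x)) ∨ g = (fun x => sin (k * x)))} ⊆
      (fun (k : ℕ) (x : ℝ) => cos (k * x)) '' (Set.Iic N) ∪ (fun (k : ℕ) (x : ℝ) => sin (k * x)) '' (Set.Iic N) := by
    rintro g ⟨k, hk, rfl | rfl⟩
    · exact Or.inl ⟨k, hk, rfl⟩
    · exact Or.inr ⟨k, hk, rfl⟩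
  exact (((Set.finite_Iic N).image _).union ((Set.finite_Iic N).image _)).subset this

/-- derivative on trigonometric polynomials -/
noncomputable def D (N : ℕ) : Module.End ℝ (TP N) where
  toFun p := ⟨deriv p, (TP_deriv p.2).2⟩
  map_add' p q := by
    ext x
    exact deriv_add ((TP_deriv p.2).1 x) ((TP_deriv q.2).1 x)
  map_smul' c p := by
    ext x
    exact deriv_const_smul c ((TP_deriv p.2).1 x)

lemma D_has {N : ℕ} (p : TP N) (x : ℝ) : HasDerivAt (p : ℝ → ℝ) ((D N p : ℝ → ℝ) x) x :=
  ((TP_deriv p.2).1 x).hasDerivAt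

lemma D_bd {N : ℕ} (p : TP N) {M : ℝ} (h : Bd p M) : Bd (D N p) (2 * (N + 1) * M) := by
  have := bernstein (N := N + 1) (by omega) (TP_mono (by omega) p.2) h
  push_cast at this
  exact this

lemma D_chain {N : ℕ} (p : TP N) (r : ℕ) : IsChain r (fun i => (((D N) ^ i) p : TP N)) := by
  refine ⟨fun i _ => TP_le_E N (((D N) ^ i) p).2, fun i _ x => ?_⟩
  have := D_has (((D N) ^ i) p) x
  beta_reduce
  rw [pow_succ']
  exact this

lemma D_pow_eq {N r : ℕ} (p : TP N) (U : ℕ → ℝ → ℝ) (hU : IsChain r U) (h0 : (p : ℝ → ℝ) = U 0) :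
    ∀ i, i ≤ r → ((((D N) ^ i) p : TP N) : ℝ → ℝ) = U i := by
  intro i
  induction i with
  | zero => intro _; simpa using h0
  | succ i ih =>
    intro hi
    funext x
    have h1 := D_has (((D N) ^ i) p) x
    rw [ih (by omega)] at h1
    rw [pow_succ']
    exact h1.unique (hU.2 i (by omega) x)

/-- convolution on trigonometric polynomials -/
noncomputable def CX (N : ℕ) (w : ℝ → ℝ) (hw : w ∈ TP N) : Module.End ℝ (TP N) where
  toFun p := ⟨C w p, C_mem hw (TP_le_E N p.2)⟩
  map_add' p q := by
    apply Subtype.ext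
    exact C_add (TP_le_E N hw).1 (TP_le_E N p.2).1 (TP_le_E N q.2).1
  map_smul' c p := by
    apply Subtype.ext
    exact C_smul c

lemma CX_comm_D {N : ℕ} {w : ℝ → ℝ} (hw : w ∈ TP N) : Commute (D N) (CX N w hw) := by
  apply LinearMap.ext
  intro p
  apply Subtype.ext
  funext x
  have h1 := D_has (CX N w hw p) x
  have h2 := C_deriv (K := w) (TP_le_E N hw).1 (D_has p) (TP_le_E N (D N p).2) x
  exact h1.unique h2

/-- resolvent -/
lemma resolvent (N : ℕ) (l : ℝ) : ∃ A : Module.End ℝ (TP N), (1 + l • D N) * A = 1 ∧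
    A * (1 + l • D N) = 1 ∧ ∀ p : TP N, ∀ M, Bd p M → Bd (A p) M := by
  set B : Module.End ℝ (TP N) := 1 + l • D N with hB
  have key : ∀ p : TP N, ∀ M, Bd (B p) M → Bd p M := by
    intro p M h
    exact max_principle (TP_le_E N p.2) (D_has p) (l := l) h
  have hinj : Function.Injective B := by
    rw [injective_iff_map_eq_zero]
    intro p hp
    have := key p 0 (by rw [hp]; intro x; simp)
    apply Subtype.ext
    funext x
    exact abs_nonpos_iff.1 (this x)
  set e := LinearEquiv.ofInjectiveEndo B hinj with he
  have e1 : ∀ p, B (e.symm p) = p := fun p => e.apply_symm_apply p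
  have e2 : ∀ p, e.symm (B p) = p := fun p => e.symm_apply_apply p
  refine ⟨e.symm.toLinearMap, LinearMap.ext e1, LinearMap.ext e2, ?_⟩
  intro p M h
  apply key
  have := e1 p
  show Bd (B (e.symm p)) M
  rw [this]; exact h

lemma inv_commute {R : Type*} [Ring R] {A B w : R} (h1 : B * A = 1) (h2 : A * B = 1)
    (h : Commute B w) : Commute A w := by
  have h' : B * w = w * B := h
  show A * w = w * A
  calc A * w = A * (w * (B * A)) := by rw [h1, mul_one]
    _ = A * (w * B) * A := by simp only [mul_assoc]
    _ = (A * B) * w * A := by rw [← h']; simp only [mul_assoc]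
    _ = w * A := by rw [h2, one_mul]

lemma oneSub_bd {N : ℕ} {A : Module.End ℝ (TP N)} (hA : ∀ p : TP N, ∀ M, Bd p M → Bd (A p) M)
    (j : ℕ) (p : TP N) {M : ℝ} (h : Bd p M) : Bd (((1 - A) ^ j) p) (2 ^ j * M) := by
  induction j with
  | zero => simpa using h
  | succ j ih =>
    rw [pow_succ']
    have : Bd (((1 - A) ^ j) p - A (((1 - A) ^ j) p) : TP N) (2 ^ j * M + 2 ^ j * M) :=
      ih.sub (hA _ _ ih)
    exact this.mono (le_of_eq (by ring))

lemma pow_bd {N : ℕ} {A : Module.End ℝ (TP N)} (hA : ∀ p : TP N, ∀ M, Bd p M → Bd (A p) M)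
    (j : ℕ) (p : TP N) {M : ℝ} (h : Bd p M) : Bd ((A ^ j) p) M := by
  induction j with
  | zero => simpa using h
  | succ j ih => rw [pow_succ']; exact hA _ _ ih

lemma ring_aux {R : Type*} [Ring R] (a : R) (j : ℕ) :
    1 - (1 - a) ^ (j + 1) = (1 - (1 - a) ^ j) + (1 - a) ^ j * a := by
  rw [pow_succ, mul_sub, mul_one]; abel

lemma S_bd {N : ℕ} {A : Module.End ℝ (TP N)} (hA : ∀ p : TP N, ∀ M, Bd p M → Bd (A p) M)
    (j : ℕ) (p : TP N) {M : ℝ} (h : Bd (A p) M) :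
    Bd ((1 - (1 - A) ^ j : Module.End ℝ (TP N)) p) ((2 ^ j - 1) * M) := by
  induction j with
  | zero => intro x; simp
  | succ j ih =>
    have h1 := oneSub_bd hA j (A p) h
    have e : (1 - (1 - A) ^ (j + 1) : Module.End ℝ (TP N)) = (1 - (1 - A) ^ j) + (1 - A) ^ j * A := 
      ring_aux A j
    rw [e]
    have : Bd ((((1 - (1 - A) ^ j : Module.End ℝ (TP N)) p) + ((1 - A) ^ j) (A p) : TP N) : ℝ → ℝ) _ :=
      ih.add h1
    exact this.mono (le_of_eq (by ring))

lemma BD_bd {N : ℕ} {l : ℝ} (hl : 0 ≤ l) (j : ℕ) (p : TP N) {M : ℝ} (h : Bd p M) :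
    Bd (((1 + l • D N) ^ j) p) ((1 + l * (2 * (N + 1))) ^ j * M) := by
  induction j with
  | zero => simpa using h
  | succ j ih =>
    rw [pow_succ']
    have h2 : Bd ((((1 + l • D N) ^ j) p + l • D N (((1 + l • D N) ^ j) p) : TP N) : ℝ → ℝ) _ :=
      ih.add ((D_bd _ ih).smul l)
    refine h2.mono (le_of_eq ?_)
    rw [abs_of_nonneg hl]; ring

lemma half_trick {F : ℝ → ℝ} {a : ℝ} (h0 : ∃ M, Bd F M) (h : ∀ M, Bd F M → Bd F (a + M / 2)) :
    Bd F (2 * a) := by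
  obtain ⟨M, hM⟩ := h0
  have hb : BddAbove (Set.range fun x => |F x|) := ⟨M, by rintro _ ⟨x, rfl⟩; exact hM x⟩
  have h1 : Bd F (⨆ x, |F x|) := fun x => le_ciSup hb x
  have h2 : (⨆ x, |F x|) ≤ a + (⨆ x, |F x|) / 2 := ciSup_le (h _ h1)
  exact h1.mono (by linarith)

lemma E_bdd {f : ℝ → ℝ} (hf : f ∈ E) : ∃ M, Bd f M := by
  obtain ⟨M, hM⟩ := (hf.2.compact_of_continuous (by positivity) hf.1).isBounded.exists_norm_le
  exact ⟨M, fun x => hM _ ⟨x, rfl⟩⟩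

lemma near_best {m : ℕ} {v f P : ℝ → ℝ} (hv : Continuous v) (hb : mean (fun t => |v t|) ≤ 3)
    (hf : f ∈ E) (hP : P ∈ TP m) (hr : C v P = P) {M : ℝ} (h : Bd (f - P) M) :
    Bd (f - C v f) (4 * M) := by
  have hPc := (TP_le_E _ hP).1
  have h1 : Bd (C v (f - P)) (3 * M) := C_bd hv (hf.1.sub hPc) hb h
  have e : f - C v f = (f - P) - C v (f - P) := by
    rw [C_sub hv hf.1 hPc, hr]; abel
  rw [e]
  exact (h.sub h1).mono (le_of_eq (by ring))

end Trig

namespace Trig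

lemma ring1 {R : Type*} [Ring R] {A d : R} (h1 : (1 + d) * A = 1) (h2 : A * (1 + d) = 1) (r : ℕ) :
    (1 - A) ^ r = A ^ r * d ^ r := by
  have e1 : 1 - A = A * d := by rw [← h2]; noncomm_ring
  have e2 : 1 - A = d * A := by rw [← h1]; noncomm_ring
  have hc : Commute A d := e1.symm.trans e2
  rw [e1, hc.mul_pow]

lemma ring2 {R : Type*} [Ring R] {A d : R} (h1 : (1 + d) * A = 1) (h2 : A * (1 + d) = 1) (r : ℕ) :
    (1 + d) ^ r * (1 - A) ^ r = d ^ r := by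
  have hc : Commute (1 + d) (1 - A) := by
    show (1 + d) * (1 - A) = (1 - A) * (1 + d)
    rw [mul_sub, sub_mul, h1, h2, mul_one, one_mul]
  rw [← hc.mul_pow, mul_sub, h1, mul_one, add_sub_cancel_left]

lemma fwd_iter_add (t : ℝ) (f g : ℝ → ℝ) (r : ℕ) :
    (fwdDiff t)^[r] (f + g) = (fwdDiff t)^[r] f + (fwdDiff t)^[r] g :=
  fwdDiff_iter_add t f g r

lemma End_add {N : ℕ} (X Y : Module.End ℝ (TP N)) (p : TP N) :
    ((X + Y) p : ℝ → ℝ) = (X p : ℝ → ℝ) + (Y p : ℝ → ℝ) := rfl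

lemma upper {r m n N : ℕ} (hr : 1 ≤ r) (hn : n ≤ 8 * (m + 1)) (hn1 : 1 ≤ n) (hmN : m ≤ 4 * m)
    {v : ℝ → ℝ} (hv : v ∈ TP N) (hvb : mean (fun t => |v t|) ≤ 3)
    (hvr : ∀ p ∈ TP (4 * m), C v p = p) {L l : ℝ} (hL : 0 ≤ L) (hl : l = L / (m + 1))
    {A : Module.End ℝ (TP N)} (h1 : (1 + l • D N) * A = 1) (h2 : A * (1 + l • D N) = 1)
    (hA : ∀ p : TP N, ∀ M, Bd p M → Bd (A p) M)
    {f : ℝ → ℝ} (hf : f ∈ E) {Ω : ℝ}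
    (hΩ : ∀ t, 0 ≤ t → t ≤ 1 / (n : ℝ) → Bd ((fwdDiff t)^[r] f) Ω) :
    Bd (f - (((1 - (1 - A) ^ r : Module.End ℝ (TP N)) ⟨C v f, C_mem hv hf⟩ : TP N) : ℝ → ℝ))
      ((4 * (1 + (112 * r) ^ r) + 3 * 2 ^ r + 3 * (16 * r * L) ^ r) * Ω) := by
  have hn0 : (0:ℝ) < n := by exact_mod_cast hn1
  have hm0 : (0:ℝ) < m + 1 := by positivity
  have hnm : (n:ℝ) ≤ 8 * (m + 1) := by exact_mod_cast hn
  have hl0 : 0 ≤ l := by rw [hl]; positivity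
  have hvc := (TP_le_E N hv).1
  obtain ⟨U, hU, hU0, hUr⟩ := kfun r hr hf (by positivity : 0 < 1 / (n : ℝ)) hΩ
  have hΩ0 := hU0.nonneg
  obtain ⟨P, hP, hPb⟩ := jackson_r m r U hU _ hUr
  have hb1 : Bd (f - P) ((1 + (112 * r) ^ r) * Ω) := by
    have := hU0.add hPb
    rw [sub_add_sub_cancel] at this
    refine this.mono ?_
    rw [add_mul, one_mul, ← mul_assoc, ← mul_pow]
    have key : 7 / ((m:ℝ) + 1) * (2 * r / (1 / n)) ≤ 112 * r := by
      have e : 7 / ((m:ℝ) + 1) * (2 * r / (1 / n)) = 14 * r * n / (m + 1) := by field_simp; ring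
      rw [e, div_le_iff₀ hm0]
      have : (0:ℝ) ≤ r := by positivity
      nlinarith [mul_le_mul_of_nonneg_left hnm this]
    have := pow_le_pow_left₀ (by positivity) key r
    gcongr
  have hb2 : Bd (f - C v f) (4 * ((1 + (112 * r) ^ r) * Ω)) :=
    near_best hvc hvb hf hP (hvr P (TP_mono hmN hP)) hb1
  have hU0E := hU.1 0 (by omega)
  have hfU : f - U 0 ∈ E := E.sub_mem hf hU0E
  have hb3 := oneSub_bd hA r ⟨C v (f - U 0), C_mem hv hfU⟩ (C_bd hvc hfU.1 hvb hU0)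
  set q : TP N := ⟨C v (U 0), C_mem hv hU0E⟩ with hq
  have e4 : (((1 - A) ^ r) q : ℝ → ℝ) = l ^ r • ((A ^ r) (((D N) ^ r) q) : ℝ → ℝ) := by
    have e : (1 - A) ^ r = A ^ r * (l • D N) ^ r := ring1 (R := Module.End ℝ (TP N)) h1 h2 r
    rw [e, smul_pow, mul_smul_comm]; rfl
  have e5 : ((((D N) ^ r) q : TP N) : ℝ → ℝ) = C v (U r) :=
    D_pow_eq q _ (hU.conv hv) rfl r le_rfl
  have hb5 : Bd ((((D N) ^ r) q : TP N) : ℝ → ℝ) (3 * ((2 * r / (1 / n)) ^ r * Ω)) := by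
    rw [e5]; exact C_bd hvc (hU.1 r le_rfl).1 hvb hUr
  have hb6 : Bd (((1 - A) ^ r) q : ℝ → ℝ) (3 * (16 * r * L) ^ r * Ω) := by
    rw [e4]
    refine ((pow_bd hA r _ hb5).smul (l ^ r)).mono ?_
    rw [abs_of_nonneg (by positivity)]
    have : l ^ r * (3 * ((2 * r / (1 / n)) ^ r * Ω)) = 3 * (l * (2 * r / (1 / n))) ^ r * Ω := by
      rw [mul_pow]; ring
    rw [this]
    have key : l * (2 * r / (1 / n)) ≤ 16 * r * L := by
      rw [hl]
      have e : L / (m + 1) * (2 * r / (1 / n)) = 2 * r * L * n / (m + 1) := by field_simp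
      rw [e, div_le_iff₀ hm0]
      have : (0:ℝ) ≤ 2 * r * L := by positivity
      nlinarith [mul_le_mul_of_nonneg_left hnm this]
    have := pow_le_pow_left₀ (by positivity) key r
    gcongr
  have esum : (⟨C v f, C_mem hv hf⟩ : TP N) = ⟨C v (f - U 0), C_mem hv hfU⟩ + q := by
    apply Subtype.ext
    show C v f = C v (f - U 0) + C v (U 0)
    rw [C_sub hvc hf.1 hU0E.1]; abel
  have efin : f - (((1 - (1 - A) ^ r : Module.End ℝ (TP N)) ⟨C v f, C_mem hv hf⟩ : TP N) : ℝ → ℝ) =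
      (f - C v f) + ((((1 - A) ^ r) ⟨C v (f - U 0), C_mem hv hfU⟩ : TP N) : ℝ → ℝ)
        + (((1 - A) ^ r) q : ℝ → ℝ) := by
    have : (((1 - A) ^ r) ⟨C v f, C_mem hv hf⟩ : TP N) =
      ((1 - A) ^ r) ⟨C v (f - U 0), C_mem hv hfU⟩ + ((1 - A) ^ r) q := by rw [esum, map_add]
    have h' := congrArg (Subtype.val) this
    show f - (C v f - (((1 - A) ^ r) ⟨C v f, C_mem hv hf⟩ : TP N).1) = _
    rw [h', sub_sub_eq_add_sub, add_sub_right_comm, add_assoc]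
    rfl
  rw [efin]
  refine ((hb2.add hb3).add hb6).mono (le_of_eq (by ring))

end Trig

namespace Trig

lemma comm_one_sub {R : Type*} [Ring R] {a b : R} (h : Commute a b) : Commute (1 - a) b :=
  (Commute.one_left _).sub_left h

lemma commA {N : ℕ} {l : ℝ} {A : Module.End ℝ (TP N)} (h1 : (1 + l • D N) * A = 1)
    (h2 : A * (1 + l • D N) = 1) {w : ℝ → ℝ} (hw : w ∈ TP N) : Commute A (CX N w hw) := by
  refine inv_commute (R := Module.End ℝ (TP N)) h1 h2 ?_
  exact (Commute.one_left _).add_left ((CX_comm_D hw).smul_left l)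

lemma commApow {N : ℕ} {l : ℝ} {A : Module.End ℝ (TP N)} (h1 : (1 + l • D N) * A = 1)
    (h2 : A * (1 + l • D N) = 1) {w : ℝ → ℝ} (hw : w ∈ TP N) (r : ℕ) :
    Commute ((1 - A) ^ r) (CX N w hw) :=
  Commute.pow_left (comm_one_sub (R := Module.End ℝ (TP N)) (commA h1 h2 hw)) r

lemma lower {r m n N : ℕ} (hn : m + 1 ≤ n) (hN : N = 8 * m)
    {v w w' : ℝ → ℝ} (hv : v ∈ TP N) (hvb : mean (fun t => |v t|) ≤ 3)
    (hvr : ∀ p ∈ TP (4 * m), C v p = p)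
    (hw : w ∈ TP (4 * m)) (hwb : mean (fun t => |w t|) ≤ 3) (hwr : ∀ p ∈ TP (2 * m), C w p = p)
    (hw' : w' ∈ TP (2 * m)) (hwb' : mean (fun t => |w' t|) ≤ 3) (hwr' : ∀ p ∈ TP m, C w' p = p)
    {L l : ℝ} (hL : L = 336 * 2 ^ r) (hl : l = L / (m + 1))
    {A : Module.End ℝ (TP N)} (h1 : (1 + l • D N) * A = 1) (h2 : A * (1 + l • D N) = 1)
    (hA : ∀ p : TP N, ∀ M, Bd p M → Bd (A p) M)
    {f : ℝ → ℝ} (hf : f ∈ E) {G : ℝ}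
    (hG : Bd (f - (((1 - (1 - A) ^ r : Module.End ℝ (TP N)) ⟨C v f, C_mem hv hf⟩ : TP N) : ℝ → ℝ)) G)
    {t : ℝ} (ht0 : 0 ≤ t) (ht : t ≤ 1 / (n : ℝ)) :
    Bd ((fwdDiff t)^[r] f) ((2 ^ r * 8 + 3 * (1 + 16 * L) ^ r) * G) := by
  have hm0 : (0:ℝ) < m + 1 := by positivity
  have hmn : (m:ℝ) + 1 ≤ n := by exact_mod_cast hn
  have h2r : (1:ℝ) ≤ 2 ^ r := one_le_pow₀ (by norm_num)
  have hL1 : 1 ≤ L := by rw [hL]; linarith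
  have hl0 : 0 < l := by rw [hl]; positivity
  have hG0 := hG.nonneg
  have hvc := (TP_le_E _ hv).1
  have hwc := (TP_le_E _ hw).1
  have hwc' := (TP_le_E _ hw').1
  have hwN : w ∈ TP N := TP_mono (by omega) hw
  have hwN' : w' ∈ TP N := TP_mono (by omega) hw'
  set S : Module.End ℝ (TP N) := 1 - (1 - A) ^ r with hS
  set V : TP N := ⟨C v f, C_mem hv hf⟩ with hV
  set q : TP N := ⟨C w f, C_mem hwN hf⟩ with hq
  have hVE := TP_le_E _ V.2
  have hWV : CX N w hwN V = q := by
    apply Subtype.ext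
    show C w (C v f) = C w f
    rw [C_comm hwc hvc hf.1, hvr _ (C_mem hw hf)]
  have hWV' : CX N w' hwN' V = CX N w' hwN' q := by
    apply Subtype.ext
    show C w' (C v f) = C w' (C w f)
    rw [C_comm hwc' hvc hf.1, hvr _ (TP_mono (by omega) (C_mem hw' hf)), C_comm hwc' hwc hf.1,
      hwr _ (C_mem hw' hf)]
  set p : TP N := V - q with hp
  have hp0 : CX N w' hwN' p = 0 := by rw [hp, map_sub, hWV', sub_self]
  set u : TP N := A p with hu
  have hu0 : CX N w' hwN' u = 0 := by
    have : A (CX N w' hwN' p) = CX N w' hwN' (A p) :=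
      LinearMap.congr_fun (commA h1 h2 hwN') p
    rw [hu, ← this, hp0, map_zero]
  have hu0' : C w' u = 0 := congrArg Subtype.val hu0
  -- bound for u
  have hub : ∀ M, Bd p M → Bd u (56 / L * M) := by
    intro M hM
    have huM : Bd u M := hA p M hM
    have e : u + l • D N u = p := LinearMap.congr_fun h1 p
    have e' : D N u = l⁻¹ • (p - u) := by
      rw [← e, add_sub_cancel_left, smul_smul, inv_mul_cancel₀ hl0.ne', one_smul]
    have hDu : Bd (D N u) (l⁻¹ * (M + M)) := by
      rw [e']
      have := (hM.sub huM).smul l⁻¹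
      rw [abs_of_pos (by positivity)] at this
      exact this
    obtain ⟨P, hP, hPb⟩ := jackson_r m 1 _ (D_chain u 1) _ (by simpa using hDu)
    have hPb' : Bd ((u : ℝ → ℝ) - P) ((7 / (m + 1)) ^ 1 * (l⁻¹ * (M + M))) := hPb
    have := near_best hwc' hwb' (TP_le_E _ u.2) hP (hwr' P hP) hPb'
    rw [hu0', sub_zero] at this
    refine this.mono (le_of_eq ?_)
    rw [hl]; field_simp; ring
  set g : ℝ → ℝ := f - (S V : ℝ → ℝ) with hg
  have hgE : g ∈ E := E.sub_mem hf (TP_le_E _ (S V).2)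
  have hWS : CX N w hwN (S V) = S q := by
    have hc : Commute S (CX N w hwN) := 
      comm_one_sub (R := Module.End ℝ (TP N)) (commApow h1 h2 hwN r)
    have : S (CX N w hwN V) = CX N w hwN (S V) := LinearMap.congr_fun hc V
    rw [← this, hWV]
  have hSq : S q = q - ((1 - A) ^ r) q := rfl
  have hCg : C w g = (((1 - A) ^ r) q : TP N) := by
    have e1 : C w (S V : ℝ → ℝ) = (S q : ℝ → ℝ) := congrArg Subtype.val hWS
    rw [hg, C_sub hwc hf.1 (TP_le_E _ (S V).2).1, e1, hSq]
    show C w f - (C w f - _) = _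
    rw [sub_sub_cancel]
  have hCgb : Bd (C w g) (3 * G) := C_bd hwc hgE.1 hwb hG
  set F : ℝ → ℝ := f - (q : ℝ → ℝ) with hF
  have hFE : F ∈ E := E.sub_mem hf (TP_le_E _ q.2)
  have hpF : (p : ℝ → ℝ) = C v F := by
    rw [hF, C_sub hvc hf.1 (TP_le_E _ q.2).1, hvr q (C_mem hw hf)]
    rfl
  have hFdec : F = (g - C w g) + (S p : ℝ → ℝ) := by
    have e1 : (S p : ℝ → ℝ) = (S V : ℝ → ℝ) - (S q : ℝ → ℝ) := by
      rw [hp, map_sub]; rfl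
    have e2 : (S q : ℝ → ℝ) = (q : ℝ → ℝ) - ((((1 - A) ^ r) q : TP N) : ℝ → ℝ) := by rw [hSq]; rfl
    rw [e1, e2, hCg, hg, hF]
    abel
  have hFb : Bd F (2 * (4 * G)) := by
    refine half_trick (E_bdd hFE) fun M hM => ?_
    have hpb : Bd p (3 * M) := by rw [hpF]; exact C_bd hvc hFE.1 hvb hM
    have hM0 := hM.nonneg
    have hSp := S_bd hA r p (hub _ hpb)
    have : Bd F (G + 3 * G + (2 ^ r - 1) * (56 / L * (3 * M))) := by
      rw [hFdec]; exact (hG.sub hCgb).add hSp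
    refine this.mono ?_
    have : (2 ^ r - 1) * (56 / L * (3 * M)) ≤ M / 2 := by
      calc (2 ^ r - 1) * (56 / L * (3 * M)) ≤ 2 ^ r * (56 / L * (3 * M)) := by
            gcongr; linarith
        _ = M / 2 := by rw [hL]; field_simp; ring
    linarith
  have hBr : (1 + l • D N) ^ r * (1 - A) ^ r = (l • D N) ^ r :=
    ring2 (R := Module.End ℝ (TP N)) h1 h2 r
  have hq1 : Bd ((((1 - A) ^ r) q : TP N) : ℝ → ℝ) (3 * G) := by rw [← hCg]; exact hCgb
  have hq2 := BD_bd hl0.le r _ hq1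
  have hq3 : ((1 + l • D N) ^ r) (((1 - A) ^ r) q) = l ^ r • ((D N) ^ r) q := by
    have := LinearMap.congr_fun hBr q
    rw [smul_pow] at this
    exact this
  have hDq : Bd ((((D N) ^ r) q : TP N) : ℝ → ℝ) ((l ^ r)⁻¹ * ((1 + 16 * L) ^ r * (3 * G))) := by
    have e : ((D N) ^ r) q = (l ^ r)⁻¹ • ((1 + l • D N) ^ r) (((1 - A) ^ r) q) := by
      rw [hq3, smul_smul, inv_mul_cancel₀ (by positivity), one_smul]
    rw [e]
    have h3 := hq2.smul (l ^ r)⁻¹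
    rw [abs_of_pos (by positivity)] at h3
    refine Bd.mono h3 ?_
    have key : 1 + l * (2 * ((N:ℝ) + 1)) ≤ 1 + 16 * L := by
      rw [hl, hN]
      push_cast
      rw [div_mul_eq_mul_div]
      have : L * (2 * (8 * (m:ℝ) + 1)) / (m + 1) ≤ 16 * L := by
        rw [div_le_iff₀ hm0]; nlinarith
      linarith
    have := pow_le_pow_left₀ (by positivity) key r
    gcongr
  have htl : t ≤ l := by
    refine ht.trans ?_
    rw [hl]
    exact div_le_div₀ (by linarith) hL1 hm0 hmn
  have hfin : (fwdDiff t)^[r] f = (fwdDiff t)^[r] F + (fwdDiff t)^[r] (q : ℝ → ℝ) := by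
    rw [← fwd_iter_add, hF, sub_add_cancel]
  rw [hfin]
  have hs : Bd ((fwdDiff t)^[r] (q : ℝ → ℝ)) _ := fwd_smooth ht0 r _ (D_chain q r) _ hDq
  refine ((fwd_iter_bd hFb r).add hs).mono ?_
  have key : t ^ r * ((l ^ r)⁻¹ * ((1 + 16 * L) ^ r * (3 * G))) ≤ (1 + 16 * L) ^ r * (3 * G) := by
    rw [← mul_assoc]
    apply mul_le_of_le_one_left (by positivity)
    rw [← div_eq_mul_inv, div_le_one (by positivity)]
    exact pow_le_pow_left₀ ht0 htl r
  linarith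

/-- the operator -/
noncomputable def Vop (N : ℕ) (v : ℝ → ℝ) (hv : v ∈ TP N) : E →ₗ[ℝ] TP N where
  toFun f := ⟨C v f, C_mem hv f.2⟩
  map_add' f g := by
    apply Subtype.ext
    exact C_add (TP_le_E N hv).1 f.2.1 g.2.1
  map_smul' c f := by
    apply Subtype.ext
    exact C_smul c

lemma core (r : ℕ) (hr : 1 ≤ r) : ∃ c C₁ : ℝ, 0 < C₁ ∧ ∀ n : ℕ, ∃ T : E →ₗ[ℝ] TP n, 1 ≤ n →
    ∀ f : E, (∀ Ω, (∀ t, 0 ≤ t → t ≤ 1 / (n : ℝ) → Bd ((fwdDiff t)^[r] (f : ℝ → ℝ)) Ω) →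
        Bd ((f : ℝ → ℝ) - (T f : ℝ → ℝ)) (c * Ω)) ∧
      (∀ G, Bd ((f : ℝ → ℝ) - (T f : ℝ → ℝ)) G → ∀ t, 0 ≤ t → t ≤ 1 / (n : ℝ) →
        Bd ((fwdDiff t)^[r] (f : ℝ → ℝ)) (C₁ * G)) := by
  set L : ℝ := 336 * 2 ^ r with hL
  refine ⟨4 * (1 + (112 * r) ^ r) + 3 * 2 ^ r + 3 * (16 * r * L) ^ r,
    2 ^ r * 8 + 3 * (1 + 16 * L) ^ r, by positivity, fun n => ?_⟩
  set m := n / 8 with hm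
  obtain ⟨v, hv, hvb, hvr⟩ := VP_exists (4 * m)
  obtain ⟨w, hw, hwb, hwr⟩ := VP_exists (2 * m)
  obtain ⟨w', hw', hwb', hwr'⟩ := VP_exists m
  have hv : v ∈ TP (8 * m) := TP_mono (by omega) hv
  have hw : w ∈ TP (4 * m) := TP_mono (by omega) hw
  obtain ⟨A, h1, h2, hA⟩ := resolvent (8 * m) (L / (m + 1))
  refine ⟨(Submodule.inclusion (TP_mono (by omega : 8 * m ≤ n))).comp
    ((1 - (1 - A) ^ r : Module.End ℝ (TP (8 * m))).comp (Vop (8 * m) v hv)), fun hn f => ⟨?_, ?_⟩⟩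
  · intro Ω hΩ
    exact upper (m := m) hr (by omega) hn (by omega) hv hvb hvr (by positivity) rfl h1 h2 hA f.2 hΩ
  · intro G hG t ht0 ht
    exact lower (m := m) (n := n) (by omega) rfl hv hvb hvr hw hwb hwr hw' hwb' hwr' hL rfl h1 h2 hA
      f.2 hG ht0 ht

end Trig

namespace Trig

lemma TP_real {n : ℕ} {g : ℝ → ℝ} (hg : g ∈ TP n) : IsRealTrigPoly n g := by
  refine TP_ind (p := IsRealTrigPoly n) ?_ ?_ ?_ ?_ ?_ hg
  · intro k hk
    refine ⟨fun j => if j = k then 1 else 0, fun _ => 0, ?_⟩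
    funext x
    rw [Finset.sum_eq_single k]
    · simp
    · intro j _ hj; simp [hj]
    · intro h; exact absurd (Finset.mem_range.2 (by omega)) h
  · intro k hk
    refine ⟨fun _ => 0, fun j => if j = k then 1 else 0, ?_⟩
    funext x
    rw [Finset.sum_eq_single k]
    · simp
    · intro j _ hj; simp [hj]
    · intro h; exact absurd (Finset.mem_range.2 (by omega)) h
  · exact ⟨fun _ => 0, fun _ => 0, by funext x; simp⟩
  · rintro f g _ _ ⟨a, b, rfl⟩ ⟨a', b', rfl⟩
    refine ⟨a + a', b + b', ?_⟩
    funext x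
    simp only [Pi.add_apply]
    rw [← Finset.sum_add_distrib]
    exact Finset.sum_congr rfl fun k _ => by ring
  · rintro c f _ ⟨a, b, rfl⟩
    refine ⟨c • a, c • b, ?_⟩
    funext x
    simp only [Pi.smul_apply, smul_eq_mul]
    rw [Finset.mul_sum]
    exact Finset.sum_congr rfl fun k _ => by ring

lemma mod_bd {r : ℕ} {f : ℝ → ℝ} (hf : f ∈ E) {h t : ℝ} (ht0 : 0 ≤ t) (ht : t ≤ h) :
    Bd ((fwdDiff t)^[r] f) (modulusSmoothness r f h) := by
  obtain ⟨M, hM⟩ := E_bdd hf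
  intro x
  refine le_csSup ⟨2 ^ r * M, ?_⟩ ⟨t, x, ht0, ht, by rw [fwd_iter_eq]⟩
  rintro _ ⟨s, y, _, _, rfl⟩
  rw [← fwd_iter_eq]
  exact fwd_iter_bd hM r y

lemma mod_le {r : ℕ} {f : ℝ → ℝ} {h M : ℝ} (hh : 0 ≤ h)
    (H : ∀ t, 0 ≤ t → t ≤ h → Bd ((fwdDiff t)^[r] f) M) : modulusSmoothness r f h ≤ M := by
  refine csSup_le ⟨_, 0, 0, le_rfl, hh, rfl⟩ ?_
  rintro _ ⟨s, y, h0, h1, rfl⟩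
  rw [← fwd_iter_eq]
  exact H s h0 h1 y

end Trig

/-- **Trigub, 1965.** For every `r ∈ ℕ` there exist constants `0 < c₁ ≤ c₂` and a sequence of
linear polynomial operators `T_n` mapping continuous `2π`-periodic functions into
trigonometric polynomials of degree at most `n` such that for every continuous `2π`-periodic
`f` and every `n`, `c₁·ω_r(f,1/n) ≤ sup_x |f(x) − T_n f(x)| ≤ c₂·ω_r(f,1/n)`. -/
theorem trigub_linear_realization_of_modulus (r : ℕ) (hr : 1 ≤ r) :
    ∃ (c₁ c₂ : ℝ), 0 < c₁ ∧ c₁ ≤ c₂ ∧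
    ∃ T : ℕ → (ℝ → ℝ) → (ℝ → ℝ),
      (∀ n : ℕ, ∀ f, Continuous f → Function.Periodic f (2 * Real.pi) →
        ∀ g, Continuous g → Function.Periodic g (2 * Real.pi) →
          T n (f + g) = T n f + T n g) ∧
      (∀ n : ℕ, ∀ (c : ℝ), ∀ f, Continuous f → Function.Periodic f (2 * Real.pi) →
        T n (c • f) = c • T n f) ∧
      (∀ n : ℕ, ∀ f, Continuous f → Function.Periodic f (2 * Real.pi) →
        IsRealTrigPoly n (T n f)) ∧
      (∀ f : ℝ → ℝ, Continuous f → Function.Periodic f (2 * Real.pi) →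
        ∀ n : ℕ, 1 ≤ n →
          c₁ * modulusSmoothness r f (1 / n) ≤ (⨆ x : ℝ, |f x - T n f x|) ∧
          (⨆ x : ℝ, |f x - T n f x|) ≤ c₂ * modulusSmoothness r f (1 / n)) := by
  classical
  obtain ⟨c, C₁, hC, H⟩ := Trig.core r hr
  choose T hT using H
  have key : ∀ n f (h : f ∈ Trig.E), (if h : f ∈ Trig.E then ((T n ⟨f, h⟩ : Trig.TP n) : ℝ → ℝ) else 0)
      = (T n ⟨f, h⟩ : ℝ → ℝ) := fun n f h => dif_pos h
  refine ⟨C₁⁻¹, max C₁⁻¹ c, by positivity, le_max_left _ _,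
    fun n f => if h : f ∈ Trig.E then ((T n ⟨f, h⟩ : Trig.TP n) : ℝ → ℝ) else 0, ?_, ?_, ?_, ?_⟩
  · intro n f hf hf' g hg hg'
    have h1 : f ∈ Trig.E := ⟨hf, hf'⟩
    have h2 : g ∈ Trig.E := ⟨hg, hg'⟩
    beta_reduce
    rw [key n f h1, key n g h2, key n (f + g) (Trig.E.add_mem h1 h2)]
    exact congrArg Subtype.val (map_add (T n) ⟨f, h1⟩ ⟨g, h2⟩)
  · intro n a f hf hf'
    have h1 : f ∈ Trig.E := ⟨hf, hf'⟩
    beta_reduce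
    rw [key n f h1, key n (a • f) (Trig.E.smul_mem a h1)]
    exact congrArg Subtype.val (map_smul (T n) a ⟨f, h1⟩)
  · intro n f hf hf'
    have h1 : f ∈ Trig.E := ⟨hf, hf'⟩
    beta_reduce
    rw [key n f h1]
    exact Trig.TP_real (T n ⟨f, h1⟩).2
  · intro f hf hf' n hn
    have h1 : f ∈ Trig.E := ⟨hf, hf'⟩
    beta_reduce
    rw [key n f h1]
    obtain ⟨hu, hlo⟩ := hT n hn ⟨f, h1⟩
    have hb := hu _ fun t ht0 ht => Trig.mod_bd h1 ht0 ht
    have h0 : 0 ≤ modulusSmoothness r f (1 / n) :=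
      (Trig.mod_bd h1 le_rfl (by positivity : (0:ℝ) ≤ 1 / n)).nonneg
    constructor
    · have hbd : BddAbove (Set.range fun x => |f x - (T n ⟨f, h1⟩ : ℝ → ℝ) x|) :=
        ⟨_, by rintro _ ⟨x, rfl⟩; exact hb x⟩
      have hG := hlo (⨆ x : ℝ, |f x - (T n ⟨f, h1⟩ : ℝ → ℝ) x|) fun x => le_ciSup hbd x
      have := Trig.mod_le (by positivity) hG
      rw [inv_mul_le_iff₀ hC]
      exact this
    · refine (ciSup_le hb).trans ?_
      exact mul_le_mul_of_nonneg_right (le_max_right _ _) h0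
end

section
/- Let α ∈ (0,1) and f : [−1,1] → ℝ be continuous. Then the following are equivalent: (i) there is a constant M such that for every n ∈ ℕ, E_n(f)_∞ ≤ M·n^{−α}; (ii) there is a constant γ such that for all x₁, x₂ ∈ [−1,1], |f(x₁) − f(x₂)| ≤ γ·( |x₁ − x₂| / (|x₁ − x₂| + √(1−x₁²) + √(1−x₂²)) )^α. -/
open Real

/-- `E_n(f)_∞`: the best uniform approximation on `[−1,1]` of `f` by real algebraic
polynomials of degree at most `n`. -/
noncomputable def bestPolyApprox (n : ℕ) (f : ℝ → ℝ) : ℝ :=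
  sInf {M : ℝ | ∃ p : Polynomial ℝ, p.natDegree ≤ n ∧
    M = sSup ((fun x => |f x - p.eval x|) '' Set.Icc (-1 : ℝ) 1)}


/-- `n` times the Fejer kernel. -/
noncomputable def fejD (n : ℕ) (t : ℝ) : ℝ :=
  ∑ i ∈ Finset.range n, ∑ j ∈ Finset.range n, cos (((i : ℤ) - (j : ℤ) : ℤ) * t)

lemma fejD_eq (n : ℕ) (t : ℝ) :
    fejD n t = (∑ i ∈ Finset.range n, cos (i * t)) ^ 2 + (∑ i ∈ Finset.range n, sin (i * t)) ^ 2 := by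
  unfold fejD
  rw [sq, sq, Finset.sum_mul_sum, Finset.sum_mul_sum, ← Finset.sum_add_distrib]
  refine Finset.sum_congr rfl fun i _ => ?_
  rw [← Finset.sum_add_distrib]
  refine Finset.sum_congr rfl fun j _ => ?_
  push_cast
  rw [sub_mul, cos_sub]

lemma fejD_nonneg (n : ℕ) (t : ℝ) : 0 ≤ fejD n t := by
  rw [fejD_eq]; positivity

lemma fejD_le (n : ℕ) (t : ℝ) : fejD n t ≤ n ^ 2 := by
  unfold fejD
  calc _ ≤ ∑ i ∈ Finset.range n, ∑ j ∈ Finset.range n, (1 : ℝ) :=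
        Finset.sum_le_sum fun i _ => Finset.sum_le_sum fun j _ => cos_le_one _
    _ = _ := by simp [sq]

lemma fejD_neg (n : ℕ) (t : ℝ) : fejD n (-t) = fejD n t := by
  unfold fejD; simp [cos_neg]

lemma fejD_periodic (n : ℕ) : Function.Periodic (fejD n) (2 * π) := by
  intro t
  unfold fejD
  refine Finset.sum_congr rfl fun i _ => Finset.sum_congr rfl fun j _ => ?_
  rw [mul_add, cos_add_int_mul_two_pi]

lemma fejD_cont (n : ℕ) : Continuous (fejD n) := by
  unfold fejD; fun_prop

lemma dir_c (n : ℕ) (t : ℝ) :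
    2 * sin (t / 2) * (∑ i ∈ Finset.range n, cos (i * t)) = sin ((n - 1 / 2) * t) + sin (t / 2) := by
  induction n with
  | zero => simp [neg_mul]; ring_nf
  | succ n ih =>
    rw [Finset.sum_range_succ, mul_add, ih]
    push_cast
    have e1 : ((n : ℝ) - 1 / 2) * t = n * t - t / 2 := by ring
    have e2 : ((n : ℝ) + 1 - 1 / 2) * t = n * t + t / 2 := by ring
    rw [e1, e2, sin_sub, sin_add]; ring

lemma dir_s (n : ℕ) (t : ℝ) :
    2 * sin (t / 2) * (∑ i ∈ Finset.range n, sin (i * t)) = cos (t / 2) - cos ((n - 1 / 2) * t) := by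
  induction n with
  | zero => simp [neg_mul]; ring_nf
  | succ n ih =>
    rw [Finset.sum_range_succ, mul_add, ih]
    push_cast
    have e1 : ((n : ℝ) - 1 / 2) * t = n * t - t / 2 := by ring
    have e2 : ((n : ℝ) + 1 - 1 / 2) * t = n * t + t / 2 := by ring
    rw [e1, e2, cos_sub, cos_add]; ring

lemma fejD_sin_le (n : ℕ) (t : ℝ) : fejD n t * sin (t / 2) ^ 2 ≤ 1 := by
  have h1 := dir_c n t
  have h2 := dir_s n t
  rw [fejD_eq]
  set A := ∑ i ∈ Finset.range n, cos (i * t)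
  set B := ∑ i ∈ Finset.range n, sin (i * t)
  have e : 4 * ((A ^ 2 + B ^ 2) * sin (t / 2) ^ 2) = (2 * sin (t / 2) * A) ^ 2 + (2 * sin (t / 2) * B) ^ 2 := by ring
  rw [h1, h2] at e
  set a := (n - 1 / 2) * t
  nlinarith [sin_sq_add_cos_sq a, sin_sq_add_cos_sq (t / 2), sq_nonneg (sin a - sin (t/2)),
    sq_nonneg (cos a + cos (t/2))]

lemma int_sin (M : ℤ) (φ : ℝ) :
    ∫ t in (-π)..π, sin (M * t + φ) = if M = 0 then 2 * π * sin φ else 0 := by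
  split_ifs with h
  · simp only [h, Int.cast_zero, zero_mul, zero_add, intervalIntegral.integral_const, smul_eq_mul]; ring
  · have hM : (M : ℝ) ≠ 0 := by exact_mod_cast h
    rw [intervalIntegral.integral_comp_mul_add (fun x => sin x) hM, integral_sin]
    have : (M : ℝ) * π + φ = M * -π + φ + M * (2 * π) := by ring
    rw [this, cos_add_int_mul_two_pi]; simp

lemma int_fejD (n : ℕ) : ∫ t in (-π)..π, fejD n t = 2 * π * n := by
  unfold fejD
  rw [intervalIntegral.integral_finsetSum
    (fun i _ => (by fun_prop : Continuous _).intervalIntegrable _ _)]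
  have : ∀ i ∈ Finset.range n, (∫ t in (-π)..π, ∑ j ∈ Finset.range n,
      cos (((i : ℤ) - (j : ℤ) : ℤ) * t)) = 2 * π := by
    intro i hi
    rw [intervalIntegral.integral_finsetSum
      (fun i _ => (by fun_prop : Continuous _).intervalIntegrable _ _)]
    have : ∀ j ∈ Finset.range n, (∫ t in (-π)..π, cos (((i : ℤ) - (j : ℤ) : ℤ) * t))
        = if i = j then 2 * π else 0 := by
      intro j _
      have := int_sin ((i : ℤ) - (j : ℤ)) (π / 2)
      simp only [sin_add_pi_div_two, sin_pi_div_two, mul_one] at this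
      rw [this]
      congr 1
      simp [sub_eq_zero]
    rw [Finset.sum_congr rfl this, Finset.sum_ite_eq, if_pos hi]
  rw [Finset.sum_congr rfl this]; simp; ring

lemma count (n k : ℕ) (hk : k ≤ n) (c : ℝ) :
    ∑ i ∈ Finset.range n, ∑ j ∈ Finset.range n, (if j + (n - k) = i then c else 0) = k * c := by
  rw [Finset.sum_comm]
  simp only [Finset.sum_ite_eq, Finset.mem_range]
  rw [← Finset.sum_filter, Finset.sum_const]
  have : Finset.filter (fun j => j + (n - k) < n) (Finset.range n) = Finset.range k := by
    ext j; simp; omega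
  rw [this]; simp

lemma bern_T (n k : ℕ) (hk : k ≤ n) (θ : ℝ) :
    ∫ t in (-π)..π, cos (k * (θ + t)) * sin (n * t) * fejD n t = - (π * (k * sin (k * θ))) := by
  have key : ∀ i ∈ Finset.range n, ∀ j ∈ Finset.range n,
      (∫ t in (-π)..π, cos (k * (θ + t)) * sin (n * t) * cos (((i : ℤ) - (j : ℤ) : ℤ) * t))
      = (if j + (n - k) = i then - (π / 2 * sin (k * θ)) else 0) +
        (if i + (n - k) = j then - (π / 2 * sin (k * θ)) else 0) := by
    intro i hi j hj
    simp only [Finset.mem_range] at hi hj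
    set m : ℤ := (i : ℤ) - (j : ℤ) with hm
    have e : ∀ t : ℝ, cos (k * (θ + t)) * sin (n * t) * cos (m * t) =
        1 / 4 * (sin (((n + k + m : ℤ) : ℝ) * t + k * θ) + sin (((n + k - m : ℤ) : ℝ) * t + k * θ)
        + sin (((n - k + m : ℤ) : ℝ) * t + -(k * θ)) + sin (((n - k - m : ℤ) : ℝ) * t + -(k * θ))) := by
      intro t
      push_cast
      have e1 : ((n : ℝ) + k + m) * t + k * θ = (n * t + k * (θ + t)) + m * t := by ring
      have e2 : ((n : ℝ) + k - m) * t + k * θ = (n * t + k * (θ + t)) - m * t := by ring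
      have e3 : ((n : ℝ) - k + m) * t + -(k * θ) = (n * t - k * (θ + t)) + m * t := by ring
      have e4 : ((n : ℝ) - k - m) * t + -(k * θ) = (n * t - k * (θ + t)) - m * t := by ring
      rw [e1, e2, e3, e4]
      simp only [sin_add, sin_sub, cos_add, cos_sub]
      ring
    simp only [e]
    have I : ∀ (M : ℤ) (φ : ℝ), IntervalIntegrable (fun t : ℝ => sin (M * t + φ))
      MeasureTheory.volume (-π) π := fun M φ => (by fun_prop : Continuous _).intervalIntegrable _ _
    rw [intervalIntegral.integral_const_mul,
      intervalIntegral.integral_add (((I _ _).add (I _ _)).add (I _ _)) (I _ _),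
      intervalIntegral.integral_add ((I _ _).add (I _ _)) (I _ _),
      intervalIntegral.integral_add (I _ _) (I _ _), int_sin, int_sin, int_sin, int_sin,
      if_neg (by omega), if_neg (by omega)]
    have c1 : ((n : ℤ) - k + m = 0) ↔ (i + (n - k) = j) := by omega
    have c2 : ((n : ℤ) - k - m = 0) ↔ (j + (n - k) = i) := by omega
    simp only [c1, c2, sin_neg]
    split_ifs <;> ring
  unfold fejD
  simp only [Finset.mul_sum]
  rw [intervalIntegral.integral_finsetSum
    (fun i _ => (by fun_prop : Continuous _).intervalIntegrable _ _)]
  have : ∀ i ∈ Finset.range n, (∫ t in (-π)..π, ∑ j ∈ Finset.range n,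
      cos (k * (θ + t)) * sin (n * t) * cos (((i : ℤ) - (j : ℤ) : ℤ) * t)) =
      ∑ j ∈ Finset.range n, ((if j + (n - k) = i then - (π / 2 * sin (k * θ)) else 0) +
        (if i + (n - k) = j then - (π / 2 * sin (k * θ)) else 0)) := by
    intro i hi
    rw [intervalIntegral.integral_finsetSum
      (fun i _ => (by fun_prop : Continuous _).intervalIntegrable _ _)]
    exact Finset.sum_congr rfl fun j hj => key i hi j hj
  rw [Finset.sum_congr rfl this]
  simp only [Finset.sum_add_distrib]
  rw [count n k hk, Finset.sum_comm, count n k hk]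
  ring

lemma bern_formula (n : ℕ) (p : Polynomial ℝ) (hp : p.natDegree ≤ n) (θ : ℝ) :
    ∫ t in (-π)..π, p.eval (cos (θ + t)) * sin (n * t) * fejD n t =
      π * (p.derivative.eval (cos θ) * (-sin θ)) := by
  have hmem : p ∈ Polynomial.degreeLE ℝ n := by
    rw [Polynomial.mem_degreeLE]; exact Polynomial.degree_le_of_natDegree_le hp
  rw [← Polynomial.Sequence.span_degreeLE (Polynomial.Chebyshev.chebyshevTsequence ℝ) (by simp)] at hmem
  have hD := fejD_cont n
  have I : ∀ q : Polynomial ℝ, IntervalIntegrable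
      (fun t => q.eval (cos (θ + t)) * sin (n * t) * fejD n t) MeasureTheory.volume (-π) π :=
    fun q => (by fun_prop : Continuous _).intervalIntegrable _ _
  clear hp
  induction hmem using Submodule.span_induction with
  | mem x hx =>
    obtain ⟨k, hk, rfl⟩ := hx
    have hT : ∀ φ : ℝ, (Polynomial.Chebyshev.T ℝ (k : ℤ)).eval (cos φ) = cos (k * φ) := by
      intro φ; rw [Polynomial.Chebyshev.T_real_cos]; simp
    change ∫ t in (-π)..π, (Polynomial.Chebyshev.T ℝ (k : ℤ)).eval (cos (θ + t)) * sin (n * t) * fejD n t =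
      π * ((Polynomial.Chebyshev.T ℝ (k : ℤ)).derivative.eval (cos θ) * (-sin θ))
    have d1 : HasDerivAt (fun φ => (Polynomial.Chebyshev.T ℝ (k : ℤ)).eval (cos φ))
      ((Polynomial.Chebyshev.T ℝ (k : ℤ)).derivative.eval (cos θ) * (-sin θ)) θ :=
      ((Polynomial.Chebyshev.T ℝ (k : ℤ)).hasDerivAt (cos θ)).comp θ (hasDerivAt_cos θ)
    simp only [hT] at d1 ⊢
    have d2 : HasDerivAt (fun φ : ℝ => cos (k * φ)) (-sin (k * θ) * (k * 1)) θ :=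
      ((hasDerivAt_id θ).const_mul (k : ℝ)).cos
    rw [bern_T n k hk, d1.unique d2]; ring
  | zero => simp
  | add x y _ _ hx hy =>
    simp only [Polynomial.eval_add, add_mul, Polynomial.derivative_add]
    rw [intervalIntegral.integral_add (I _) (I _), hx, hy]; ring
  | smul a x _ hx =>
    simp only [Polynomial.eval_smul, smul_eq_mul, mul_assoc, Polynomial.derivative_smul]
    simp only [mul_assoc] at hx
    rw [intervalIntegral.integral_const_mul, hx]; ring

lemma bernstein_ineq (n : ℕ) (p : Polynomial ℝ) (hp : p.natDegree ≤ n) (A : ℝ)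
    (hA : ∀ x ∈ Set.Icc (-1 : ℝ) 1, |p.eval x| ≤ A) (θ : ℝ) :
    |p.derivative.eval (cos θ) * (-sin θ)| ≤ 2 * n * A := by
  have h := bern_formula n p hp θ
  have hD := fejD_cont n
  have hpi := pi_pos
  have h2 : |∫ t in (-π)..π, p.eval (cos (θ + t)) * sin (n * t) * fejD n t| ≤
      ∫ t in (-π)..π, A * fejD n t := by
    rw [← Real.norm_eq_abs]
    refine intervalIntegral.norm_integral_le_of_norm_le (by linarith) (Filter.Eventually.of_forall fun t _ => ?_)
      ((by fun_prop : Continuous _).intervalIntegrable _ _)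
    rw [Real.norm_eq_abs, abs_mul, abs_mul, abs_of_nonneg (fejD_nonneg n t)]
    refine mul_le_mul_of_nonneg_right ?_ (fejD_nonneg n t)
    have h3 := hA (cos (θ + t)) ⟨neg_one_le_cos _, cos_le_one _⟩
    nlinarith [abs_sin_le_one (n * t), abs_nonneg (sin (n * t)), abs_nonneg (p.eval (cos (θ + t)))]
  rw [intervalIntegral.integral_const_mul, int_fejD, h, abs_mul, abs_of_pos hpi] at h2
  have : π * |p.derivative.eval (cos θ) * (-sin θ)| ≤ π * (2 * n * A) := by linarith
  exact le_of_mul_le_mul_left this hpi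

lemma bernstein_lip (n : ℕ) (p : Polynomial ℝ) (hp : p.natDegree ≤ n) (A : ℝ)
    (hA : ∀ x ∈ Set.Icc (-1 : ℝ) 1, |p.eval x| ≤ A) (a b : ℝ) :
    |p.eval (cos a) - p.eval (cos b)| ≤ 2 * n * A * |a - b| := by
  have := Convex.norm_image_sub_le_of_norm_hasDerivWithin_le (𝕜 := ℝ) (s := Set.univ)
    (f := fun φ => p.eval (cos φ)) (f' := fun φ => p.derivative.eval (cos φ) * (-sin φ))
    (C := 2 * n * A) (x := b) (y := a)
    (fun θ _ => ((p.hasDerivAt (cos θ)).comp θ (hasDerivAt_cos θ)).hasDerivWithinAt)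
    (fun θ _ => bernstein_ineq n p hp A hA θ) convex_univ trivial trivial
  exact this

lemma geo (a b : ℝ) (ha : a ∈ Set.Icc 0 π) (hb : b ∈ Set.Icc 0 π) (hab : a ≠ b) (R : ℝ)
    (hR : R = |cos a - cos b| / (|cos a - cos b| + sqrt (1 - cos a ^ 2) + sqrt (1 - cos b ^ 2))) :
    |a - b| ≤ 2 * π * R ∧ R ≤ |a - b| ∧ 0 < R ∧ R ≤ 1 := by
  have hpi := pi_pos
  obtain ⟨ha0, ha1⟩ := ha
  obtain ⟨hb0, hb1⟩ := hb
  rw [← sin_eq_sqrt_one_sub_cos_sq ha0 ha1, ← sin_eq_sqrt_one_sub_cos_sq hb0 hb1] at hR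
  wlog h : b < a generalizing a b
  · have h' : a < b := lt_of_le_of_ne (not_lt.mp h) hab
    rw [abs_sub_comm a b]
    refine this b a hab.symm ?_ hb0 hb1 ha0 ha1 h'
    rw [hR, abs_sub_comm (cos a)]; ring
  have hS : 0 < sin ((a + b) / 2) := sin_pos_of_pos_of_lt_pi (by linarith) (by linarith)
  have hs : 0 < sin ((a - b) / 2) := sin_pos_of_pos_of_lt_pi (by linarith) (by linarith)
  have hc : 0 ≤ cos ((a - b) / 2) := cos_nonneg_of_neg_pi_div_two_le_of_le (by linarith) (by linarith)
  have e1 : |cos a - cos b| = 2 * sin ((a + b) / 2) * sin ((a - b) / 2) := by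
    rw [cos_sub_cos, abs_of_neg]
    · ring
    · nlinarith [mul_pos hS hs]
  have e2 : sin a + sin b = 2 * sin ((a + b) / 2) * cos ((a - b) / 2) := by
    have h1 : sin a = sin ((a + b) / 2 + (a - b) / 2) := by congr 1; ring
    have h2 : sin b = sin ((a + b) / 2 - (a - b) / 2) := by congr 1; ring
    rw [h1, h2, sin_add, sin_sub]; ring
  rw [add_assoc, e1, e2, ← mul_add, mul_div_mul_left _ _ (by positivity)] at hR
  have hjor : 2 / π * ((a - b) / 2) ≤ sin ((a - b) / 2) := mul_le_sin (by linarith) (by linarith)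
  have hsle : sin ((a - b) / 2) ≤ (a - b) / 2 := sin_le (by linarith)
  rw [abs_of_pos (sub_pos.mpr h)]
  have hsq := sin_sq_add_cos_sq ((a - b) / 2)
  set s := sin ((a - b) / 2)
  set c := cos ((a - b) / 2)
  have h1 : 1 ≤ s + c := by nlinarith [mul_nonneg hs.le hc]
  have h2 : s + c ≤ 2 := by nlinarith [sq_nonneg (s - c)]
  have hj : a - b ≤ π * s := by
    have : 2 / π * ((a - b) / 2) = (a - b) / π := by field_simp
    rw [this, div_le_iff₀ hpi] at hjor; linarith
  have hRs : s / 2 ≤ R := by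
    rw [hR]; exact div_le_div_of_nonneg_left hs.le (by linarith) h2
  have hRs2 : R ≤ s := by
    rw [hR]; exact div_le_self hs.le h1
  refine ⟨by nlinarith, by linarith, by linarith, ?_⟩
  rw [hR]; exact div_le_one_of_le₀ (by linarith) (by linarith)

lemma inverse_thm (α : ℝ) (hα0 : 0 < α) (hα1 : α < 1) (f : ℝ → ℝ) (M : ℝ)
    (q : ℕ → Polynomial ℝ) (hq : ∀ k, (q k).natDegree ≤ 2 ^ k)
    (hqf : ∀ k, ∀ x ∈ Set.Icc (-1 : ℝ) 1, |f x - (q k).eval x| ≤ M * ((2 : ℝ) ^ k) ^ (-α)) :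
    ∃ γ : ℝ, ∀ a b R : ℝ, 0 < R → R ≤ 1 → |a - b| ≤ 2 * π * R →
      |f (cos a) - f (cos b)| ≤ γ * R ^ α := by
  have hpi := pi_pos
  have hcos : ∀ a : ℝ, cos a ∈ Set.Icc (-1 : ℝ) 1 := fun a => ⟨neg_one_le_cos _, cos_le_one _⟩
  have hM : 0 ≤ M := by
    have h1 := hqf 0 1 (by norm_num)
    simp at h1
    exact (abs_nonneg _).trans h1
  set σ : ℝ := (2 : ℝ) ^ (-α) with hσ
  have hσk : ∀ k : ℕ, ((2 : ℝ) ^ k) ^ (-α) = σ ^ k := by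
    intro k
    rw [hσ, ← rpow_natCast, ← rpow_natCast, ← rpow_mul (by norm_num), ← rpow_mul (by norm_num), mul_comm]
  have hσ0 : 0 < σ := by positivity
  have hσ1 : σ ≤ 1 := rpow_le_one_of_one_le_of_nonpos (by norm_num) (by linarith)
  have hρ : 1 < 2 * σ := by
    have : 2 * σ = (2 : ℝ) ^ (1 - α) := by
      rw [hσ, sub_eq_add_neg, rpow_add (by norm_num), rpow_one]
    rw [this]; exact one_lt_rpow (by norm_num) (by linarith)
  simp only [hσk] at hqf
  obtain ⟨A, hA⟩ : ∃ A, ∀ x ∈ Set.Icc (-1 : ℝ) 1, |(q 0).eval x| ≤ A := by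
    obtain ⟨A, hA⟩ := isCompact_Icc.exists_bound_of_continuousOn
      (s := Set.Icc (-1 : ℝ) 1) (f := fun x => (q 0).eval x) (by fun_prop)
    exact ⟨A, hA⟩
  obtain ⟨C, hC0, hC1, hC2⟩ : ∃ C : ℝ, 0 ≤ C ∧ 2 * A ≤ C ∧ 8 * M ≤ C * (2 * σ - 1) := by
    refine ⟨|2 * A| + 8 * M / (2 * σ - 1), ?_, ?_, ?_⟩
    · have : 0 < 2 * σ - 1 := by linarith
      positivity
    · have : 0 < 2 * σ - 1 := by linarith
      have h2 : 0 ≤ 8 * M / (2 * σ - 1) := by positivity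
      linarith [le_abs_self (2 * A)]
    · have : 0 < 2 * σ - 1 := by linarith
      rw [add_mul, div_mul_cancel₀ _ this.ne']
      have : 0 ≤ |2 * A| * (2 * σ - 1) := by positivity
      linarith
  have hlip : ∀ (k : ℕ) (a b : ℝ), |(q k).eval (cos a) - (q k).eval (cos b)| ≤ C * (2 * σ) ^ k * |a - b| := by
    intro k
    induction k with
    | zero =>
      intro a b
      have := bernstein_lip 1 (q 0) (by simpa using hq 0) A hA a b
      have h3 : 2 * A * |a - b| ≤ C * |a - b| := mul_le_mul_of_nonneg_right hC1 (abs_nonneg _)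
      simp at this ⊢
      linarith
    | succ k ih =>
      intro a b
      have h1 := ih a b
      have hdeg : (q (k + 1) - q k).natDegree ≤ 2 ^ (k + 1) := by
        refine (Polynomial.natDegree_sub_le _ _).trans (max_le (hq _) ((hq k).trans ?_))
        exact Nat.pow_le_pow_right (by norm_num) (by omega)
      have hsup : ∀ x ∈ Set.Icc (-1 : ℝ) 1, |(q (k + 1) - q k).eval x| ≤ 2 * M * σ ^ k := by
        intro x hx
        have h2 := hqf k x hx
        have h3 := hqf (k + 1) x hx
        have h4 : M * σ ^ (k + 1) ≤ M * σ ^ k :=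
          mul_le_mul_of_nonneg_left (pow_le_pow_of_le_one hσ0.le hσ1 (by omega)) hM
        rw [Polynomial.eval_sub]
        rw [abs_le] at h2 h3 ⊢
        constructor <;> linarith
      have h5 := bernstein_lip _ _ hdeg _ hsup a b
      have h6 : 2 * ((2 ^ (k + 1) : ℕ) : ℝ) * (2 * M * σ ^ k) = 8 * M * (2 * σ) ^ k := by
        push_cast; rw [mul_pow]; ring
      rw [h6] at h5
      have h7 : 8 * M * (2 * σ) ^ k ≤ C * (2 * σ - 1) * (2 * σ) ^ k :=
        mul_le_mul_of_nonneg_right hC2 (by positivity)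
      have h8 := mul_le_mul_of_nonneg_right h7 (abs_nonneg (a - b))
      have h9 : C * (2 * σ) ^ (k + 1) * |a - b| =
        C * (2 * σ) ^ k * |a - b| + C * (2 * σ - 1) * (2 * σ) ^ k * |a - b| := by ring
      rw [h9]
      have h10 : (q (k + 1)).eval (cos a) - (q (k + 1)).eval (cos b) =
        ((q k).eval (cos a) - (q k).eval (cos b)) +
        ((q (k + 1) - q k).eval (cos a) - (q (k + 1) - q k).eval (cos b)) := by
        simp only [Polynomial.eval_sub]; ring
      rw [h10]
      refine (abs_add_le _ _).trans ?_
      linarith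
  refine ⟨4 * M + 4 * π * C, fun a b R hR0 hR1 hab => ?_⟩
  obtain ⟨k, hk1, hk2⟩ := exists_nat_pow_near_of_lt_one hR0 hR1 (by norm_num : (0 : ℝ) < 1 / 2) (by norm_num)
  have hs : σ ^ k ≤ 2 * R ^ α := by
    have h1 : σ ^ k = ((1 / 2 : ℝ) ^ k) ^ α := by
      rw [← hσk, rpow_neg (by positivity), ← inv_rpow (by positivity)]; simp
    rw [h1]
    have h2 : ((1 / 2 : ℝ) ^ k) ≤ 2 * R := by rw [pow_succ] at hk1; linarith
    calc ((1 / 2 : ℝ) ^ k) ^ α ≤ (2 * R) ^ α := rpow_le_rpow (by positivity) h2 hα0.le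
      _ = 2 ^ α * R ^ α := mul_rpow (by norm_num) hR0.le
      _ ≤ 2 ^ (1 : ℝ) * R ^ α := by
        gcongr
        norm_num
      _ = _ := by simp
  have hr : (2 * σ) ^ k * R ≤ σ ^ k := by
    have h1 : (2 * σ) ^ k * R ≤ (2 * σ) ^ k * (1 / 2) ^ k := mul_le_mul_of_nonneg_left hk2 (by positivity)
    have h2 : (2 * σ) ^ k * (1 / 2) ^ k = σ ^ k := by rw [← mul_pow]; congr 1; ring
    linarith
  have h1 := hqf k _ (hcos a)
  have h2 := hqf k _ (hcos b)
  have h3 := hlip k a b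
  have h4 : C * (2 * σ) ^ k * |a - b| ≤ C * (2 * σ) ^ k * (2 * π * R) :=
    mul_le_mul_of_nonneg_left hab (by positivity)
  have h5 : C * (2 * σ) ^ k * (2 * π * R) ≤ 2 * π * C * (2 * R ^ α) := by
    calc _ = 2 * π * C * ((2 * σ) ^ k * R) := by ring
      _ ≤ _ := mul_le_mul_of_nonneg_left (hr.trans hs) (by positivity)
  have h6 : M * σ ^ k ≤ M * (2 * R ^ α) := mul_le_mul_of_nonneg_left hs hM
  have h7 : |f (cos a) - f (cos b)| ≤ M * σ ^ k + C * (2 * σ) ^ k * |a - b| + M * σ ^ k := by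
    rw [abs_le] at *
    constructor <;> linarith
  linarith

lemma moment (α : ℝ) (hα0 : 0 < α) (hα1 : α < 1) (n : ℕ) (hn : 1 ≤ n) :
    ∫ t in (-π)..π, |t| ^ α * fejD n t ≤ 2 * (1 + π ^ 2 / (1 - α)) * (n : ℝ) ^ (1 - α) := by
  have hpi := pi_gt_three
  have hD := fejD_cont n
  have hn' : (1 : ℝ) ≤ n := by exact_mod_cast hn
  have hn0 : (0 : ℝ) < n := by linarith
  have hcont : Continuous fun t : ℝ => |t| ^ α * fejD n t :=
    (continuous_abs.rpow_const fun _ => Or.inr hα0.le).mul hD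
  have I : ∀ a b : ℝ, IntervalIntegrable (fun t : ℝ => |t| ^ α * fejD n t) MeasureTheory.volume a b :=
    fun a b => hcont.intervalIntegrable _ _
  have hinv : (1 / n : ℝ) ≤ 1 := by rw [div_le_one hn0]; exact hn'
  have hinv0 : (0 : ℝ) < 1 / n := by positivity
  rw [← intervalIntegral.integral_add_adjacent_intervals (I (-π) 0) (I 0 π)]
  have hev : ∫ t in (-π)..0, |t| ^ α * fejD n t = ∫ t in (0)..π, |t| ^ α * fejD n t := by
    have := intervalIntegral.integral_comp_neg (a := 0) (b := π) (fun t => |t| ^ α * fejD n t)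
    simp only [abs_neg, fejD_neg, neg_zero] at this
    exact this.symm
  rw [hev, ← intervalIntegral.integral_add_adjacent_intervals (I 0 (1 / n)) (I (1 / n) π)]
  have b1 : ∫ t in (0)..(1 / n : ℝ), |t| ^ α * fejD n t ≤ (n : ℝ) ^ (1 - α) := by
    have : ∫ t in (0)..(1 / n : ℝ), |t| ^ α * fejD n t ≤ ∫ t in (0)..(1 / n : ℝ), (n : ℝ) ^ (-α) * n ^ 2 := by
      refine intervalIntegral.integral_mono_on hinv0.le (I _ _) (by simp) fun t ht => ?_
      refine mul_le_mul ?_ (fejD_le n t) (fejD_nonneg n t) (by positivity)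
      rw [abs_of_nonneg ht.1, rpow_neg hn0.le, ← inv_rpow hn0.le]
      exact rpow_le_rpow ht.1 (by simpa using ht.2) hα0.le
    refine this.trans (le_of_eq ?_)
    rw [intervalIntegral.integral_const, sub_eq_add_neg 1 α, rpow_add hn0, rpow_one, smul_eq_mul]
    field_simp
    ring
  have b2 : ∫ t in (1 / n : ℝ)..π, |t| ^ α * fejD n t ≤ π ^ 2 / (1 - α) * (n : ℝ) ^ (1 - α) := by
    have h0 : (0 : ℝ) ∉ Set.uIcc (1 / n : ℝ) π := by
      rw [Set.uIcc_of_le (by linarith)]; intro h; linarith [h.1]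
    have hint : IntervalIntegrable (fun t : ℝ => π ^ 2 * t ^ (α - 2)) MeasureTheory.volume (1 / n) π :=
      (intervalIntegral.intervalIntegrable_rpow (Or.inr h0)).const_mul _
    have : ∫ t in (1 / n : ℝ)..π, |t| ^ α * fejD n t ≤ ∫ t in (1 / n : ℝ)..π, π ^ 2 * t ^ (α - 2) := by
      refine intervalIntegral.integral_mono_on (by linarith) (I _ _) hint fun t ht => ?_
      have ht0 : 0 < t := lt_of_lt_of_le hinv0 ht.1
      have hs : t / π ≤ sin (t / 2) := by
        have := mul_le_sin (x := t / 2) (by linarith) (by linarith [ht.2])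
        have e : 2 / π * (t / 2) = t / π := by field_simp
        linarith
      have hDt : fejD n t ≤ π ^ 2 / t ^ 2 := by
        have h1 := fejD_sin_le n t
        have h2 : (t / π) ^ 2 ≤ sin (t / 2) ^ 2 := by
          have : 0 < t / π := by positivity
          gcongr
        have h3 : fejD n t * (t / π) ^ 2 ≤ 1 :=
          (mul_le_mul_of_nonneg_left h2 (fejD_nonneg n t)).trans h1
        rw [div_pow, ← mul_div_assoc, div_le_one (by positivity)] at h3
        rw [le_div_iff₀ (by positivity)]; exact h3
      rw [abs_of_pos ht0, rpow_sub ht0]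
      calc t ^ α * fejD n t ≤ t ^ α * (π ^ 2 / t ^ 2) := mul_le_mul_of_nonneg_left hDt (by positivity)
        _ = _ := by norm_cast; ring
    refine this.trans ?_
    rw [intervalIntegral.integral_const_mul, integral_rpow (Or.inr ⟨by linarith, h0⟩)]
    have e1 : α - 2 + 1 = -(1 - α) := by ring
    have e2 : (1 / n : ℝ) ^ (-(1 - α)) = (n : ℝ) ^ (1 - α) := by
      rw [one_div, inv_rpow hn0.le, rpow_neg hn0.le, inv_inv]
    rw [e1, e2, div_mul_eq_mul_div, mul_div_assoc]
    refine mul_le_mul_of_nonneg_left ?_ (by positivity)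
    have : 0 < 1 - α := by linarith
    have hp : 0 ≤ π ^ (-(1 - α)) := by positivity
    rw [div_neg, ← neg_div]
    gcongr
    linarith
  linarith

lemma fejer_poly (g : ℝ → ℝ) (hg : Continuous g) (hper : Function.Periodic g (2 * π))
    (hev : ∀ t, g (-t) = g t) (n : ℕ) :
    ∃ p : Polynomial ℝ, p.natDegree ≤ n ∧
      ∀ θ, p.eval (cos θ) = ∫ t in (-π)..π, g (θ + t) * fejD n t := by
  have hD := fejD_cont n
  refine ⟨∑ i ∈ Finset.range n, ∑ j ∈ Finset.range n,
    Polynomial.C (∫ s in (-π)..π, g s * cos (((i : ℤ) - (j : ℤ) : ℤ) * s)) *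
      Polynomial.Chebyshev.T ℝ ((i : ℤ) - (j : ℤ)), ?_, fun θ => ?_⟩
  · refine Polynomial.natDegree_sum_le_of_forall_le _ _ fun i hi =>
      Polynomial.natDegree_sum_le_of_forall_le _ _ fun j hj => ?_
    refine (Polynomial.natDegree_C_mul_le _ _).trans ?_
    rw [Polynomial.Chebyshev.natDegree_T]
    simp at hi hj
    omega
  have hodd : ∀ m : ℤ, ∫ s in (-π)..π, g s * sin (m * s) = 0 := by
    intro m
    have := intervalIntegral.integral_comp_neg (a := -π) (b := π) (fun s => g s * sin (m * s))
    simp only [hev, mul_neg, sin_neg, neg_neg, intervalIntegral.integral_neg] at this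
    linarith
  have h1 : ∫ t in (-π)..π, g (θ + t) * fejD n t = ∫ s in (-π)..π, g s * fejD n (s - θ) := by
    have := intervalIntegral.integral_comp_add_left (a := -π) (b := π) (fun s => g s * fejD n (s - θ)) θ
    simp only [add_sub_cancel_left] at this
    rw [this]
    have hp : Function.Periodic (fun s => g s * fejD n (s - θ)) (2 * π) := by
      intro s
      simp only
      rw [hper s, show s + 2 * π - θ = (s - θ) + 2 * π by ring, fejD_periodic n]
    have := hp.intervalIntegral_add_eq (θ + -π) (-π)
    rw [show θ + -π + 2 * π = θ + π by ring, show -π + 2 * π = π by ring] at this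
    exact this
  rw [h1]
  simp only [Polynomial.eval_finsetSum, Polynomial.eval_mul, Polynomial.eval_C,
    Polynomial.Chebyshev.T_real_cos]
  unfold fejD
  simp only [Finset.mul_sum]
  rw [intervalIntegral.integral_finsetSum
    (fun i _ => (by fun_prop : Continuous _).intervalIntegrable _ _)]
  refine Finset.sum_congr rfl fun i _ => ?_
  rw [intervalIntegral.integral_finsetSum
    (fun i _ => (by fun_prop : Continuous _).intervalIntegrable _ _)]
  refine Finset.sum_congr rfl fun j _ => ?_
  set m : ℤ := (i : ℤ) - (j : ℤ)
  have e : ∀ s : ℝ, g s * cos (m * (s - θ)) =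
      (g s * cos (m * s)) * cos (m * θ) + (g s * sin (m * s)) * sin (m * θ) := by
    intro s; rw [mul_sub, cos_sub]; ring
  simp only [e]
  rw [intervalIntegral.integral_add ((by fun_prop : Continuous _).intervalIntegrable _ _)
    ((by fun_prop : Continuous _).intervalIntegrable _ _),
    intervalIntegral.integral_mul_const, intervalIntegral.integral_mul_const, hodd]
  ring

lemma jackson (α : ℝ) (hα0 : 0 < α) (hα1 : α < 1) (f : ℝ → ℝ)
    (hf : ContinuousOn f (Set.Icc (-1 : ℝ) 1)) (γ : ℝ) (hγ : 0 ≤ γ)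
    (hh : ∀ a ∈ Set.Icc 0 π, ∀ b ∈ Set.Icc 0 π, |f (cos a) - f (cos b)| ≤ γ * |a - b| ^ α)
    (n : ℕ) (hn : 1 ≤ n) :
    ∃ p : Polynomial ℝ, p.natDegree ≤ n ∧ ∀ x ∈ Set.Icc (-1 : ℝ) 1,
      |f x - p.eval x| ≤ γ * (1 + π ^ 2 / (1 - α)) * (n : ℝ) ^ (-α) := by
  have hpi := pi_gt_three
  have hD := fejD_cont n
  have hn' : (1 : ℝ) ≤ n := by exact_mod_cast hn
  have hn0 : (0 : ℝ) < n := by linarith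
  set g : ℝ → ℝ := fun t => f (cos t) with hg
  have hgc : Continuous g :=
    hf.comp_continuous continuous_cos fun t => ⟨neg_one_le_cos _, cos_le_one _⟩
  have hper : Function.Periodic g (2 * π) := fun t => by simp [hg]
  have hev : ∀ t, g (-t) = g t := fun t => by simp [hg]
  obtain ⟨p, hp, hpe⟩ := fejer_poly g hgc hper hev n
  refine ⟨Polynomial.C (1 / (2 * π * n)) * p, (Polynomial.natDegree_C_mul_le _ _).trans hp, ?_⟩
  intro x hx
  obtain ⟨θ, hθ, rfl⟩ : ∃ θ ∈ Set.Icc 0 π, cos θ = x :=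
    ⟨arccos x, ⟨arccos_nonneg x, arccos_le_pi x⟩, cos_arccos hx.1 hx.2⟩
  have hloc : ∀ t ∈ Set.Icc (-π) π, |g θ - g (θ + t)| ≤ γ * |t| ^ α := by
    intro t ht
    have aux : ∀ b ∈ Set.Icc 0 π, g b = g (θ + t) → |θ - b| ≤ |t| → |g θ - g (θ + t)| ≤ γ * |t| ^ α := by
      intro b hb hgb hle
      rw [← hgb]
      refine (hh θ hθ b hb).trans ?_
      gcongr
    obtain ⟨ht1, ht2⟩ := ht
    obtain ⟨h1, h2⟩ := hθ
    by_cases c1 : θ + t < 0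
    · refine aux (-(θ + t)) ⟨by linarith, by linarith⟩ (hev _) ?_
      rw [abs_of_neg (by linarith : t < 0), abs_le]
      constructor <;> linarith
    · by_cases c2 : π < θ + t
      · refine aux (2 * π - (θ + t)) ⟨by linarith, by linarith⟩ ?_ ?_
        · simp [hg]
        · rw [abs_of_pos (by linarith : 0 < t), abs_le]
          constructor <;> linarith
      · refine aux (θ + t) ⟨by linarith, by linarith⟩ rfl ?_
        rw [sub_add_cancel_left, abs_neg]
  have hpc : Continuous fun t : ℝ => |t| ^ α := continuous_abs.rpow_const fun _ => Or.inr hα0.le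
  have hdiff : f (cos θ) - (Polynomial.C (1 / (2 * π * n)) * p).eval (cos θ) =
      (∫ t in (-π)..π, (g θ - g (θ + t)) * fejD n t) / (2 * π * n) := by
    simp only [sub_mul]
    rw [intervalIntegral.integral_sub ((by fun_prop : Continuous _).intervalIntegrable _ _)
      ((by fun_prop : Continuous _).intervalIntegrable _ _), intervalIntegral.integral_const_mul, int_fejD,
      Polynomial.eval_mul, Polynomial.eval_C, hpe]
    simp only [hg]
    field_simp
  have hb : |∫ t in (-π)..π, (g θ - g (θ + t)) * fejD n t| ≤ ∫ t in (-π)..π, γ * (|t| ^ α * fejD n t) := by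
    rw [← Real.norm_eq_abs]
    refine intervalIntegral.norm_integral_le_of_norm_le (by linarith) (Filter.Eventually.of_forall fun t ht => ?_)
      ((by fun_prop : Continuous _).intervalIntegrable _ _)
    rw [Real.norm_eq_abs, abs_mul, abs_of_nonneg (fejD_nonneg n t), ← mul_assoc]
    exact mul_le_mul_of_nonneg_right (hloc t ⟨ht.1.le, ht.2⟩) (fejD_nonneg n t)
  rw [intervalIntegral.integral_const_mul] at hb
  have hm := moment α hα0 hα1 n hn
  have h2 := hb.trans (mul_le_mul_of_nonneg_left hm hγ)
  rw [hdiff, abs_div, abs_of_pos (by positivity : 0 < 2 * π * n), div_le_iff₀ (by positivity)]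
  refine h2.trans ?_
  have e : (n : ℝ) ^ (1 - α) = n * (n : ℝ) ^ (-α) := by
    rw [sub_eq_add_neg, rpow_add hn0, rpow_one]
  rw [e]
  have hα' : 0 < 1 - α := by linarith
  have hX : 0 ≤ γ * (1 + π ^ 2 / (1 - α)) * (n : ℝ) ^ (-α) * n := by positivity
  nlinarith

theorem polynomial_approx_rate_iff_pointwise_holder
    (α : ℝ) (hα0 : 0 < α) (hα1 : α < 1)
    (f : ℝ → ℝ) (hf : ContinuousOn f (Set.Icc (-1 : ℝ) 1)) :
    (∃ M : ℝ, ∀ n : ℕ, 1 ≤ n → bestPolyApprox n f ≤ M * (n : ℝ) ^ (-α)) ↔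
    (∃ γ : ℝ, ∀ x₁ ∈ Set.Icc (-1 : ℝ) 1, ∀ x₂ ∈ Set.Icc (-1 : ℝ) 1,
      |f x₁ - f x₂| ≤ γ *
        (|x₁ - x₂| / (|x₁ - x₂| + Real.sqrt (1 - x₁ ^ 2) + Real.sqrt (1 - x₂ ^ 2))) ^ α) := by
  have harc : ∀ x ∈ Set.Icc (-1 : ℝ) 1, ∃ θ ∈ Set.Icc 0 π, cos θ = x := fun x hx =>
    ⟨arccos x, ⟨arccos_nonneg x, arccos_le_pi x⟩, cos_arccos hx.1 hx.2⟩
  constructor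
  · rintro ⟨M, hM⟩
    have hex : ∀ k : ℕ, ∃ q : Polynomial ℝ, q.natDegree ≤ 2 ^ k ∧ ∀ x ∈ Set.Icc (-1 : ℝ) 1,
        |f x - q.eval x| ≤ (M + 1) * ((2 : ℝ) ^ k) ^ (-α) := by
      intro k
      have h1 := hM (2 ^ k) Nat.one_le_two_pow
      push_cast at h1
      have h2 : bestPolyApprox (2 ^ k) f < (M + 1) * ((2 : ℝ) ^ k) ^ (-α) := by
        have : 0 < ((2 : ℝ) ^ k) ^ (-α) := by positivity
        linarith
      obtain ⟨_, ⟨q, hq, rfl⟩, hlt⟩ := exists_lt_of_csInf_lt (s := {M : ℝ | ∃ p : Polynomial ℝ, p.natDegree ≤ 2 ^ k ∧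
        M = sSup ((fun x => |f x - p.eval x|) '' Set.Icc (-1 : ℝ) 1)}) ⟨_, 0, by simp, rfl⟩ h2
      refine ⟨q, hq, fun x hx => ?_⟩
      refine le_trans (le_csSup ?_ (Set.mem_image_of_mem (fun x => |f x - q.eval x|) hx)) hlt.le
      refine (isCompact_Icc.image_of_continuousOn ?_).bddAbove
      exact (hf.sub (by fun_prop)).abs
    choose q hq hqf using hex
    obtain ⟨γ, hγ⟩ := inverse_thm α hα0 hα1 f (M + 1) q hq hqf
    refine ⟨γ, fun x₁ h₁ x₂ h₂ => ?_⟩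
    obtain ⟨a, ha, rfl⟩ := harc x₁ h₁
    obtain ⟨b, hb, rfl⟩ := harc x₂ h₂
    by_cases hab : a = b
    · subst hab; simp [zero_rpow hα0.ne']
    · obtain ⟨g1, g2, g3, g4⟩ := geo a b ha hb hab _ rfl
      exact hγ a b _ g3 g4 g1
  · rintro ⟨γ, hγ⟩
    have hh : ∀ a ∈ Set.Icc 0 π, ∀ b ∈ Set.Icc 0 π,
        |f (cos a) - f (cos b)| ≤ |γ| * |a - b| ^ α := by
      intro a ha b hb
      by_cases hab : a = b
      · subst hab; simp [zero_rpow hα0.ne']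
      · obtain ⟨g1, g2, g3, g4⟩ := geo a b ha hb hab _ rfl
        refine (hγ _ ⟨neg_one_le_cos a, cos_le_one a⟩ _ ⟨neg_one_le_cos b, cos_le_one b⟩).trans ?_
        exact mul_le_mul (le_abs_self γ) (rpow_le_rpow g3.le g2 hα0.le)
          (rpow_nonneg g3.le _) (abs_nonneg _)
    refine ⟨|γ| * (1 + π ^ 2 / (1 - α)), fun n hn => ?_⟩
    obtain ⟨p, hp, hpe⟩ := jackson α hα0 hα1 f hf (|γ|) (abs_nonneg _) hh n hn
    unfold bestPolyApprox
    refine (csInf_le (s := {M : ℝ | ∃ p : Polynomial ℝ, p.natDegree ≤ n ∧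
        M = sSup ((fun x => |f x - p.eval x|) '' Set.Icc (-1 : ℝ) 1)})
        ⟨0, ?_⟩ ⟨p, hp, rfl⟩).trans ?_
    · rintro _ ⟨q, _, rfl⟩
      refine Real.sSup_nonneg ?_
      rintro _ ⟨x, _, rfl⟩
      exact abs_nonneg _
    · refine csSup_le ((Set.nonempty_Icc.mpr (by norm_num)).image _) ?_
      rintro _ ⟨x, hx, rfl⟩
      exact hpe x hx
end

section
/- (Timan) For every r ∈ ℕ ∪ {0} there exists a constant c(r) such that for every r times continuously differentiable function f : [−1,1] → ℝ and every integer n ≥ r+1 there exists a real algebraic polynomial p_n of degree at most n such that for all x ∈ [−1,1]: |f(x) − p_n(x)| ≤ c(r)·δ_n(x)^r·ω(f^{(r)}; δ_n(x)), where δ_n(x) = √(1−x²)/n + 1/n². -/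
open Real

/-- The modulus of continuity of `g` on `[−1,1]`:
`ω(g;h) = sup{|g(x) − g(y)| : x,y ∈ [−1,1], |x−y| ≤ h}`. -/
noncomputable def modulusOn (g : ℝ → ℝ) (h : ℝ) : ℝ :=
  sSup {v : ℝ | ∃ x ∈ Set.Icc (-1 : ℝ) 1, ∃ y ∈ Set.Icc (-1 : ℝ) 1,
    |x - y| ≤ h ∧ v = |g x - g y|}


noncomputable def tSym (u : ℝ) : ℕ → Polynomial ℝ
  | 0 => Polynomial.C 2
  | 1 => Polynomial.C (2 * cos u) * Polynomial.X
  | (j+2) => Polynomial.C (2 * cos u) * (Polynomial.X * tSym u (j+1))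
      - (Polynomial.C (cos u ^ 2 - 1) * tSym u j + Polynomial.X * (Polynomial.X * tSym u j))

lemma tSym_eval (u θ : ℝ) : ∀ j, (tSym u j).eval (cos θ) = cos (u - θ) ^ j + cos (u + θ) ^ j
  | 0 => by simp [tSym]; norm_num
  | 1 => by simp [tSym, cos_sub, cos_add]; ring
  | (j+2) => by
    simp only [tSym, Polynomial.eval_sub, Polynomial.eval_add, Polynomial.eval_mul,
      Polynomial.eval_C, Polynomial.eval_X, tSym_eval u θ j, tSym_eval u θ (j+1)]
    have h1 : cos (u - θ) + cos (u + θ) = 2 * cos u * cos θ := by rw [cos_sub, cos_add]; ring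
    have h2 : cos (u - θ) * cos (u + θ) = cos u ^ 2 - 1 + cos θ ^ 2 := by
      rw [cos_sub, cos_add]
      have := sin_sq_add_cos_sq u
      have := sin_sq_add_cos_sq θ
      have e1 : sin u ^ 2 = 1 - cos u ^ 2 := by linarith
      have e2 : sin θ ^ 2 = 1 - cos θ ^ 2 := by linarith
      have : (cos u * cos θ + sin u * sin θ) * (cos u * cos θ - sin u * sin θ)
        = cos u ^ 2 * cos θ ^ 2 - sin u ^ 2 * sin θ ^ 2 := by ring
      rw [this, e1, e2]; ring
    generalize cos (u - θ) = A at *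
    generalize cos (u + θ) = B at *
    linear_combination (- (A^(j+1) + B^(j+1))) * h1 + (A^j + B^j) * h2

lemma tSym_deg (u : ℝ) : ∀ j, (tSym u j).natDegree ≤ j
  | 0 => by simp [tSym]
  | 1 => by
    rw [tSym]
    exact (Polynomial.natDegree_C_mul_le _ _).trans (by simp)
  | (j+2) => by
    have h0 := tSym_deg u j
    have h1 := tSym_deg u (j+1)
    have hX : ∀ p : Polynomial ℝ, (Polynomial.X * p).natDegree ≤ p.natDegree + 1 := by
      intro p
      refine Polynomial.natDegree_mul_le.trans ?_
      simp [add_comm]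
    rw [tSym]
    refine (Polynomial.natDegree_sub_le _ _).trans (max_le ?_ ?_)
    · refine (Polynomial.natDegree_C_mul_le _ _).trans ?_
      have := hX (tSym u (j+1)); omega
    · refine (Polynomial.natDegree_add_le _ _).trans (max_le ?_ ?_)
      · refine (Polynomial.natDegree_C_mul_le _ _).trans ?_
        omega
      · have := hX (tSym u j); have := hX (Polynomial.X * tSym u j); omega

lemma tSym_cont : ∀ j i, Continuous fun u => (tSym u j).coeff i
  | 0, i => by simp only [tSym]; exact continuous_const
  | 1, i => by
    simp only [tSym, Polynomial.coeff_C_mul]; fun_prop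
  | (j+2), i => by
    have hX : ∀ p : ℝ → Polynomial ℝ, (∀ i, Continuous fun u => (p u).coeff i) →
        ∀ i, Continuous fun u => (Polynomial.X * p u).coeff i := by
      intro p hp i
      cases i with
      | zero => simp only [Polynomial.coeff_X_mul_zero]; exact continuous_const
      | succ i => simp only [Polynomial.coeff_X_mul]; exact hp i
    have a := hX _ (tSym_cont (j+1)) i
    have b := tSym_cont j i
    have c := hX _ (hX _ (tSym_cont j)) i
    simp only [tSym, Polynomial.coeff_C_mul, Polynomial.coeff_sub, Polynomial.coeff_add]
    fun_prop

lemma conv_poly (P : Polynomial ℝ) (G : ℝ → ℝ) (hG : Continuous G)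
    (hper : Function.Periodic G (2 * π)) (heven : ∀ u, G (-u) = G u) :
    ∃ p : Polynomial ℝ, p.natDegree ≤ P.natDegree ∧ ∀ θ,
      p.eval (cos θ) = ∫ t in (-π)..π, G (θ + t) * P.eval (cos t) := by
  classical
  set d := P.natDegree with hd
  set a : ℕ → ℝ → ℝ := fun i u => ∑ k ∈ Finset.range (d + 1), P.coeff k * (tSym u k).coeff i with ha
  have hac : ∀ i, Continuous (a i) := by
    intro i
    refine continuous_finsetSum _ fun k _ => ?_
    exact continuous_const.mul (tSym_cont k i)
  have key : ∀ u θ, P.eval (cos (u - θ)) + P.eval (cos (u + θ))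
      = ∑ i ∈ Finset.range (d + 1), a i u * cos θ ^ i := by
    intro u θ
    rw [Polynomial.eval_eq_sum_range, Polynomial.eval_eq_sum_range, ← Finset.sum_add_distrib]
    simp only [ha, Finset.sum_mul]
    rw [Finset.sum_comm]
    refine Finset.sum_congr rfl fun k hk => ?_
    rw [← mul_add, ← tSym_eval, Polynomial.eval_eq_sum_range'
      (n := d + 1) (lt_of_le_of_lt (tSym_deg u k) (Finset.mem_range.1 hk)), Finset.mul_sum]
    refine Finset.sum_congr rfl fun i _ => ?_
    ring
  refine ⟨∑ i ∈ Finset.range (d + 1), Polynomial.C ((∫ u in (-π)..π, G u * a i u) / 2) *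
    Polynomial.X ^ i, ?_, ?_⟩
  · refine Polynomial.natDegree_sum_le_of_forall_le _ _ fun i hi => ?_
    refine (Polynomial.natDegree_C_mul_X_pow_le _ _).trans ?_
    have := Finset.mem_range.1 hi
    omega
  · intro θ
    have hPc : Continuous fun t => P.eval (cos t) := P.continuous.comp continuous_cos
    have e1 : ∫ t in (-π)..π, G (θ + t) * P.eval (cos t)
        = ∫ u in (-π)..π, G u * P.eval (cos (u - θ)) := by
      have h1 : ∫ t in (-π)..π, G (θ + t) * P.eval (cos t)
        = ∫ t in (-π)..π, (fun u => G u * P.eval (cos (u - θ))) (θ + t) := by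
        simp
      rw [h1, intervalIntegral.integral_comp_add_left (fun u => G u * P.eval (cos (u - θ)))]
      have hp : Function.Periodic (fun u => G u * P.eval (cos (u - θ))) (2 * π) := by
        intro u
        have : u + 2 * π - θ = (u - θ) + 2 * π := by ring
        simp only [hper u, this, cos_add_two_pi]
      have := hp.intervalIntegral_add_eq (θ + -π) (-π)
      rw [show θ + -π + 2 * π = θ + π by ring, show -π + 2 * π = π by ring] at this
      exact this
    have e2 : ∫ u in (-π)..π, G u * P.eval (cos (u - θ))
        = ∫ u in (-π)..π, G u * P.eval (cos (u + θ)) := by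
      have := intervalIntegral.integral_comp_neg (a := -π) (b := π)
        (fun u => G u * P.eval (cos (u - θ)))
      rw [neg_neg] at this
      rw [← this]
      refine intervalIntegral.integral_congr fun u _ => ?_
      simp only [heven]
      rw [show -u - θ = -(u + θ) by ring, cos_neg]
    have e3 : (∫ u in (-π)..π, G u * P.eval (cos (u - θ))) +
        ∫ u in (-π)..π, G u * P.eval (cos (u + θ)) =
        ∑ i ∈ Finset.range (d + 1), (∫ u in (-π)..π, G u * a i u) * cos θ ^ i := by
      rw [← intervalIntegral.integral_add]
      · rw [intervalIntegral.integral_congr (g := fun u => ∑ i ∈ Finset.range (d + 1),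
          (G u * a i u) * cos θ ^ i)]
        · rw [intervalIntegral.integral_finsetSum]
          · simp
          · intro i _
            exact ((hG.mul (hac i)).mul continuous_const).intervalIntegrable _ _
        · intro u _
          simp only
          rw [← mul_add, key, Finset.mul_sum]
          exact Finset.sum_congr rfl fun i _ => by ring
      · exact (hG.mul (P.continuous.comp (by fun_prop))).intervalIntegrable _ _
      · exact (hG.mul (P.continuous.comp (by fun_prop))).intervalIntegrable _ _
    rw [e1, Polynomial.eval_finsetSum]
    simp only [Polynomial.eval_mul, Polynomial.eval_C, Polynomial.eval_pow, Polynomial.eval_X]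
    have : ∑ i ∈ Finset.range (d + 1), (∫ u in (-π)..π, G u * a i u) / 2 * cos θ ^ i
      = (∑ i ∈ Finset.range (d + 1), (∫ u in (-π)..π, G u * a i u) * cos θ ^ i) / 2 := by
      rw [Finset.sum_div]; exact Finset.sum_congr rfl fun i _ => by ring
    rw [this, ← e3, ← e2]; ring

noncomputable def dirP : ℕ → Polynomial ℝ
  | 0 => 1
  | (m+1) => dirP m + Polynomial.C 2 * Polynomial.Chebyshev.T ℝ ((m : ℤ) + 1)

lemma dirP_deg (m : ℕ) : (dirP m).natDegree ≤ m := by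
  induction m with
  | zero => simp [dirP]
  | succ m ih =>
    rw [dirP]
    refine (Polynomial.natDegree_add_le _ _).trans (max_le (by omega) ?_)
    refine (Polynomial.natDegree_C_mul_le _ _).trans ?_
    rw [Polynomial.Chebyshev.natDegree_T]
    omega

lemma dirP_succ (m : ℕ) (t : ℝ) : (dirP (m+1)).eval (cos t) =
    (dirP m).eval (cos t) + 2 * cos ((m + 1) * t) := by
  rw [dirP]
  simp only [Polynomial.eval_add, Polynomial.eval_mul, Polynomial.eval_C,
    Polynomial.Chebyshev.T_real_cos]
  push_cast
  rfl

lemma dirP_abs (m : ℕ) (t : ℝ) : |(dirP m).eval (cos t)| ≤ 2 * m + 1 := by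
  induction m with
  | zero => simp [dirP]
  | succ m ih =>
    rw [dirP_succ]
    have h := abs_cos_le_one ((m + 1) * t)
    have h2 := abs_add_le ((dirP m).eval (cos t)) (2 * cos ((m + 1) * t))
    rw [abs_mul, abs_two] at h2
    push_cast
    linarith

lemma dirP_sin (m : ℕ) (t : ℝ) :
    (dirP m).eval (cos t) * sin (t / 2) = sin ((2 * m + 1) * (t / 2)) := by
  induction m with
  | zero => simp [dirP]
  | succ m ih =>
    rw [dirP_succ, add_mul, ih]
    push_cast
    have e1 : (2 * (m : ℝ) + 1) * (t / 2) = (m + 1) * t - t / 2 := by ring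
    have e2 : (2 * ((m : ℝ) + 1) + 1) * (t / 2) = (m + 1) * t + t / 2 := by ring
    rw [e1, e2, sin_sub, sin_add]
    ring

lemma dirP_lower (M m : ℕ) (hm : m ≤ M) (t : ℝ) (ht : M * |t| ≤ 1) :
    (m : ℝ) + 1 ≤ (dirP m).eval (cos t) := by
  induction m with
  | zero => simp [dirP]
  | succ m ih =>
    rw [dirP_succ]
    have h := ih (by omega)
    have h1 : |((m : ℝ) + 1) * t| ≤ 1 := by
      rw [abs_mul, abs_of_nonneg (by positivity)]
      refine le_trans ?_ ht
      gcongr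
      exact_mod_cast hm
    have h2 := one_sub_sq_div_two_le_cos (x := ((m : ℝ) + 1) * t)
    have h3 : (((m : ℝ) + 1) * t) ^ 2 ≤ 1 := by
      rw [← sq_abs]; nlinarith [abs_nonneg (((m : ℝ) + 1) * t)]
    push_cast
    linarith

lemma dirP_upper (m : ℕ) (hm : 1 ≤ m) (t : ℝ) (ht : |t| ≤ π) :
    |(dirP m).eval (cos t)| * (1 + m * |t|) ≤ 7 * m := by
  have hm' : (1 : ℝ) ≤ m := by exact_mod_cast hm
  have h1 := dirP_abs m t
  have h2 : |(dirP m).eval (cos t)| * |sin (t / 2)| ≤ 1 := by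
    rw [← abs_mul, dirP_sin]; exact abs_sin_le_one _
  have h3 : 2 / π * |t / 2| ≤ |sin (t / 2)| := by
    apply mul_abs_le_abs_sin
    rw [abs_div, abs_two]; linarith
  have h4 : 2 / π * |t / 2| = |t| / π := by
    rw [abs_div, abs_two]; ring
  rw [h4] at h3
  have h5 : |(dirP m).eval (cos t)| * (|t| / π) ≤ 1 :=
    (mul_le_mul_of_nonneg_left h3 (abs_nonneg _)).trans h2
  have h6 : |(dirP m).eval (cos t)| * |t| ≤ π := by
    rw [← mul_div_assoc, div_le_one pi_pos] at h5
    exact h5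
  have := pi_lt_four
  nlinarith

lemma kernel_lemma (j : ℕ) : ∃ C : ℝ, 0 ≤ C ∧ ∃ d : ℕ, ∀ m : ℕ, 1 ≤ m → ∀ g : ℝ → ℝ,
    ContinuousOn g (Set.Icc (-1) 1) → ∃ p : Polynomial ℝ, p.natDegree ≤ d * m ∧
      ∀ θ B : ℝ, (∀ t, |g (cos θ) - g (cos (θ + t))| ≤ B * (1 + m * |t|) ^ j) →
        |g (cos θ) - p.eval (cos θ)| ≤ C * B := by
  set s := j + 1 with hs
  refine ⟨7 ^ (2 * s) * π / 2, by positivity, 2 * s, ?_⟩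
  intro m hm g hg
  have hm' : (1 : ℝ) ≤ m := by exact_mod_cast hm
  have hm0 : (0 : ℝ) < m := by linarith
  have hpi := pi_pos
  set G : ℝ → ℝ := fun u => g (cos u) with hGdef
  have hG : Continuous G :=
    hg.comp_continuous continuous_cos fun u => ⟨neg_one_le_cos u, cos_le_one u⟩
  set P := dirP m ^ (2 * s) with hP
  have hPc : Continuous fun t => P.eval (cos t) := P.continuous.comp continuous_cos
  have hPe : ∀ t, P.eval (cos t) = ((dirP m).eval (cos t)) ^ (2 * s) := by
    intro t; rw [hP, Polynomial.eval_pow]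
  have hP0 : ∀ t, 0 ≤ P.eval (cos t) := by
    intro t; rw [hPe, pow_mul]; positivity
  obtain ⟨p, hpd, hp⟩ := conv_poly P G hG (fun u => by simp [hGdef]) (fun u => by simp [hGdef])
  set L := ∫ t in (-π)..π, P.eval (cos t) with hL
  -- lower bound
  have hLlow : 2 * (m : ℝ) ^ (2 * s) / m ≤ L := by
    have hmi : (1 : ℝ) / m ≤ 1 := by rw [div_le_one hm0]; exact hm'
    have hmp : 0 < (1 : ℝ) / m := by positivity
    have hp3 := pi_gt_three
    have h1 : ∫ t in (-(1 / (m : ℝ)))..(1 / m), P.eval (cos t) ≤ L := by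
      refine intervalIntegral.integral_mono_interval (by linarith) (by linarith) (by linarith) ?_
        (hPc.intervalIntegrable _ _)
      exact Filter.Eventually.of_forall hP0
    have h2 : ∫ t in (-(1 / (m : ℝ)))..(1 / m), (m : ℝ) ^ (2 * s) ≤
        ∫ t in (-(1 / (m : ℝ)))..(1 / m), P.eval (cos t) := by
      refine intervalIntegral.integral_mono_on (by linarith) (by simp)
        (hPc.intervalIntegrable _ _) ?_
      intro t ht
      rw [hPe]
      have : (m : ℝ) * |t| ≤ 1 := by
        have : |t| ≤ 1 / m := abs_le.2 ⟨ht.1, ht.2⟩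
        calc (m : ℝ) * |t| ≤ m * (1 / m) := by gcongr
          _ = 1 := by field_simp
      have := dirP_lower m m le_rfl t this
      gcongr
      linarith
    rw [intervalIntegral.integral_const, smul_eq_mul] at h2
    refine le_trans (le_of_eq ?_) (h2.trans h1)
    ring
  have hLpos : 0 < L := lt_of_lt_of_le (by positivity) hLlow
  -- upper bound
  have hup : ∀ t ∈ Set.Icc (-π) π, (1 + m * |t|) ^ j * P.eval (cos t) ≤
      (7 * m) ^ (2 * s) * (1 + (m * t) ^ 2)⁻¹ := by
    intro t ht
    have ha : |t| ≤ π := abs_le.2 ⟨ht.1, ht.2⟩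
    have h1 := dirP_upper m hm t ha
    have hq : 1 ≤ 1 + m * |t| := by have : 0 ≤ m * |t| := by positivity
                                    linarith
    have h2 : (1 + m * |t|) ^ (2 * s) * P.eval (cos t) ≤ (7 * m) ^ (2 * s) := by
      rw [hPe, ← Even.pow_abs (even_two_mul s) ((dirP m).eval (cos t)), ← mul_pow, mul_comm]
      gcongr
    rw [← div_eq_mul_inv, le_div_iff₀ (by positivity)]
    refine le_trans ?_ h2
    have h3 : 1 + (m * t) ^ 2 ≤ (1 + m * |t|) ^ 2 := by
      have : (m * t) ^ 2 = (m * |t|) ^ 2 := by rw [mul_pow, mul_pow, sq_abs]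
      rw [this]
      have : 0 ≤ m * |t| := by positivity
      nlinarith
    calc (1 + m * |t|) ^ j * P.eval (cos t) * (1 + (m * t) ^ 2)
        ≤ (1 + m * |t|) ^ j * P.eval (cos t) * (1 + m * |t|) ^ 2 := by
          have := hP0 t
          gcongr
      _ = (1 + m * |t|) ^ (j + 2) * P.eval (cos t) := by ring
      _ ≤ (1 + m * |t|) ^ (2 * s) * P.eval (cos t) := by
          have := hP0 t
          gcongr
          omega
  have hupI : ∫ t in (-π)..π, (1 + m * |t|) ^ j * P.eval (cos t) ≤
      (7 * m) ^ (2 * s) * (π / m) := by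
    have hc2 : Continuous fun t : ℝ => (1 + (m * t) ^ 2)⁻¹ := by
      refine Continuous.inv₀ (by fun_prop) fun t => by positivity
    calc ∫ t in (-π)..π, (1 + m * |t|) ^ j * P.eval (cos t)
        ≤ ∫ t in (-π)..π, (7 * (m : ℝ)) ^ (2 * s) * (1 + ((m : ℝ) * t) ^ 2)⁻¹ := by
          refine intervalIntegral.integral_mono_on (by linarith) ?_ ?_ hup
          · exact Continuous.intervalIntegrable (by fun_prop) _ _
          · exact Continuous.intervalIntegrable (by fun_prop) _ _
      _ = (7 * m) ^ (2 * s) * ((m : ℝ)⁻¹ * (arctan (m * π) - arctan (m * -π))) := by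
          rw [intervalIntegral.integral_const_mul,
            intervalIntegral.integral_comp_mul_left (fun t => (1 + t ^ 2)⁻¹) hm0.ne']
          rw [integral_inv_one_add_sq, smul_eq_mul]
      _ ≤ (7 * m) ^ (2 * s) * (π / m) := by
          have h1 := arctan_lt_pi_div_two (m * π)
          have h2 := neg_pi_div_two_lt_arctan (m * -π)
          rw [div_eq_inv_mul]
          gcongr
          linarith
  refine ⟨Polynomial.C L⁻¹ * p, ?_, ?_⟩
  · refine (Polynomial.natDegree_C_mul_le _ _).trans (hpd.trans ?_)
    refine Polynomial.natDegree_pow_le.trans ?_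
    exact Nat.mul_le_mul_left _ (dirP_deg m)
  · intro θ B hB
    have hB0 : 0 ≤ B := by
      have := hB 0
      simp at this
      exact this
    have hGt : Continuous fun t => G (θ + t) := by fun_prop
    have e : g (cos θ) - (Polynomial.C L⁻¹ * p).eval (cos θ) =
        L⁻¹ * ∫ t in (-π)..π, (G θ - G (θ + t)) * P.eval (cos t) := by
      rw [Polynomial.eval_mul, Polynomial.eval_C, hp]
      simp only [sub_mul]
      rw [intervalIntegral.integral_sub, intervalIntegral.integral_const_mul, ← hL]
      · rw [mul_sub, mul_comm (G θ), ← mul_assoc, inv_mul_cancel₀ hLpos.ne', one_mul]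
      · exact Continuous.intervalIntegrable (by fun_prop) _ _
      · exact Continuous.intervalIntegrable (by fun_prop) _ _
    rw [e, abs_mul, abs_of_pos (inv_pos.2 hLpos)]
    have hI : |∫ t in (-π)..π, (G θ - G (θ + t)) * P.eval (cos t)| ≤
        B * ((7 * m) ^ (2 * s) * (π / m)) := by
      refine (intervalIntegral.abs_integral_le_integral_abs (by linarith)).trans ?_
      calc ∫ t in (-π)..π, |(G θ - G (θ + t)) * P.eval (cos t)|
          ≤ ∫ t in (-π)..π, B * ((1 + m * |t|) ^ j * P.eval (cos t)) := by
            refine intervalIntegral.integral_mono_on (by linarith) ?_ ?_ ?_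
            · exact Continuous.intervalIntegrable (by fun_prop) _ _
            · exact Continuous.intervalIntegrable (by fun_prop) _ _
            · intro t _
              rw [abs_mul, abs_of_nonneg (hP0 t), ← mul_assoc]
              exact mul_le_mul_of_nonneg_right (hB t) (hP0 t)
        _ = B * ∫ t in (-π)..π, (1 + m * |t|) ^ j * P.eval (cos t) := by
            rw [intervalIntegral.integral_const_mul]
        _ ≤ _ := by gcongr
    rw [inv_mul_le_iff₀ hLpos]
    refine hI.trans ?_
    calc B * ((7 * m) ^ (2 * s) * (π / m))
        = (2 * (m : ℝ) ^ (2 * s) / m) * (7 ^ (2 * s) * π / 2 * B) := by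
          rw [mul_pow]; ring
      _ ≤ _ := by gcongr

lemma modulusOn_le (g : ℝ → ℝ) (hg : ContinuousOn g (Set.Icc (-1) 1)) (h : ℝ) {x y : ℝ}
    (hx : x ∈ Set.Icc (-1 : ℝ) 1) (hy : y ∈ Set.Icc (-1 : ℝ) 1) (hxy : |x - y| ≤ h) :
    |g x - g y| ≤ modulusOn g h := by
  obtain ⟨M, hM⟩ := isCompact_Icc.exists_bound_of_continuousOn hg
  refine le_csSup ⟨2 * M, ?_⟩ ⟨x, hx, y, hy, hxy, rfl⟩
  rintro v ⟨a, ha, b, hb, -, rfl⟩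
  have h1 := hM a ha
  have h2 := hM b hb
  rw [Real.norm_eq_abs] at h1 h2
  have := abs_sub (g a) (g b)
  linarith

lemma modulusOn_nonneg (g : ℝ → ℝ) (h : ℝ) : 0 ≤ modulusOn g h := by
  refine Real.sSup_nonneg ?_
  rintro v ⟨a, ha, b, hb, -, rfl⟩
  exact abs_nonneg _

lemma modulusOn_nat (g : ℝ → ℝ) (hg : ContinuousOn g (Set.Icc (-1) 1)) (h : ℝ) {x y : ℝ}
    (hx : x ∈ Set.Icc (-1 : ℝ) 1) (hy : y ∈ Set.Icc (-1 : ℝ) 1) (N : ℕ) (hN : 0 < N)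
    (hxy : |x - y| ≤ N * h) :
    |g x - g y| ≤ N * modulusOn g h := by
  have hN' : (0 : ℝ) < N := by exact_mod_cast hN
  set z : ℕ → ℝ := fun i => x + (i / N : ℝ) * (y - x) with hz
  have hzI : ∀ i ≤ N, z i ∈ Set.Icc (-1 : ℝ) 1 := by
    intro i hi
    have h1 : (i / N : ℝ) ≤ 1 := by
      rw [div_le_one hN']; exact_mod_cast hi
    have h0 : 0 ≤ (i / N : ℝ) := by positivity
    exact (convex_Icc (-1 : ℝ) 1).add_smul_sub_mem hx hy ⟨h0, h1⟩
  have hstep : ∀ i ≤ N, |g x - g (z i)| ≤ i * modulusOn g h := by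
    intro i
    induction i with
    | zero => intro _; simp [hz]
    | succ i ih =>
      intro hi
      have a := ih (by omega)
      have b : |g (z i) - g (z (i+1))| ≤ modulusOn g h := by
        refine modulusOn_le g hg h (hzI _ (by omega)) (hzI _ hi) ?_
        have : z i - z (i + 1) = (x - y) / N := by
          simp only [hz]; push_cast; ring
        rw [this, abs_div, abs_of_pos hN', div_le_iff₀ hN']
        linarith
      have := abs_sub_le (g x) (g (z i)) (g (z (i+1)))
      push_cast
      linarith
  have hzN : z N = y := by
    simp only [hz]; rw [div_self hN'.ne']; ring
  have := hstep N le_rfl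
  rwa [hzN] at this

lemma modulusOn_lip (g : ℝ → ℝ) (hg : ContinuousOn g (Set.Icc (-1) 1)) {h : ℝ} (hh : 0 < h)
    {x y : ℝ} (hx : x ∈ Set.Icc (-1 : ℝ) 1) (hy : y ∈ Set.Icc (-1 : ℝ) 1) :
    |g x - g y| ≤ (|x - y| / h + 1) * modulusOn g h := by
  have hq : 0 ≤ |x - y| / h := by positivity
  have h1 : |x - y| ≤ ((⌊|x - y| / h⌋₊ + 1 : ℕ) : ℝ) * h := by
    rw [← div_le_iff₀ hh]
    push_cast
    exact (Nat.lt_floor_add_one _).le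
  refine (modulusOn_nat g hg h hx hy _ (Nat.succ_pos _) h1).trans ?_
  have := modulusOn_nonneg g h
  gcongr
  push_cast
  have := Nat.floor_le hq
  linarith

lemma modulusOn_scale (g : ℝ → ℝ) (hg : ContinuousOn g (Set.Icc (-1) 1)) {h h' l : ℝ} (hh : 0 < h)
    (hl : 0 ≤ l) (hh' : h' ≤ l * h) :
    modulusOn g h' ≤ (l + 1) * modulusOn g h := by
  refine Real.sSup_le ?_ (mul_nonneg (by linarith) (modulusOn_nonneg g h))
  rintro v ⟨a, ha, b, hb, hab, rfl⟩
  refine (modulusOn_lip g hg hh ha hb).trans ?_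
  have := modulusOn_nonneg g h
  gcongr
  rw [div_le_iff₀ hh]; linarith

lemma exists_antideriv (q : Polynomial ℝ) : ∃ Q : Polynomial ℝ,
    Polynomial.derivative Q = q ∧ Q.natDegree ≤ q.natDegree + 1 := by
  refine ⟨∑ i ∈ Finset.range (q.natDegree + 1),
    Polynomial.C (q.coeff i / (i + 1)) * Polynomial.X ^ (i + 1), ?_, ?_⟩
  · rw [Polynomial.derivative_sum]
    conv_rhs => rw [Polynomial.as_sum_range_C_mul_X_pow q]
    refine Finset.sum_congr rfl fun i _ => ?_
    rw [Polynomial.derivative_C_mul_X_pow]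
    congr 2
    push_cast
    field_simp
  · refine Polynomial.natDegree_sum_le_of_forall_le _ _ fun i hi => ?_
    refine (Polynomial.natDegree_C_mul_X_pow_le _ _).trans ?_
    have := Finset.mem_range.1 hi
    omega

lemma small_claim (r : ℕ) : ∀ f : ℝ → ℝ, ContDiffOn ℝ r f (Set.Icc (-1 : ℝ) 1) →
    ∃ p : Polynomial ℝ, p.natDegree ≤ r ∧ ∀ M : ℝ,
      (∀ x ∈ Set.Icc (-1 : ℝ) 1, ∀ y ∈ Set.Icc (-1 : ℝ) 1,
        |iteratedDerivWithin r f (Set.Icc (-1 : ℝ) 1) x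
          - iteratedDerivWithin r f (Set.Icc (-1 : ℝ) 1) y| ≤ M) →
      ∀ x ∈ Set.Icc (-1 : ℝ) 1, |f x - p.eval x| ≤ M := by
  induction r with
  | zero =>
    intro f _
    refine ⟨Polynomial.C (f 0), by simp, ?_⟩
    intro M hM x hx
    have := hM x hx 0 (by simp)
    simpa using this
  | succ r ih =>
    intro f hf
    have hu := uniqueDiffOn_Icc (show (-1 : ℝ) < 1 by norm_num)
    obtain ⟨q, hqd, hq⟩ := ih (derivWithin f (Set.Icc (-1 : ℝ) 1))
      (hf.derivWithin hu (by norm_cast))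
    obtain ⟨Q, hQ, hQd⟩ := exists_antideriv q
    refine ⟨Q + Polynomial.C (f 0 - Q.eval 0), ?_, ?_⟩
    · rw [Polynomial.natDegree_add_C]; omega
    · intro M hM x hx
      rw [iteratedDerivWithin_succ'] at hM
      have hb := hq M hM
      have hd : ∀ y ∈ Set.Icc (-1 : ℝ) 1, HasDerivWithinAt (fun z => f z - Q.eval z)
          (derivWithin f (Set.Icc (-1 : ℝ) 1) y - q.eval y) (Set.Icc (-1 : ℝ) 1) y := by
        intro y hy
        refine HasDerivWithinAt.sub ?_ ?_
        · exact ((hf.differentiableOn (by simp)) y hy).hasDerivWithinAt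
        · rw [← hQ]; exact (Q.hasDerivAt y).hasDerivWithinAt
      have hM0 : 0 ≤ M := (abs_nonneg _).trans (hb 0 (by simp))
      have := (convex_Icc (-1 : ℝ) 1).norm_image_sub_le_of_norm_hasDerivWithin_le hd
        (fun y hy => by rw [Real.norm_eq_abs]; exact hb y hy)
        (show (0 : ℝ) ∈ Set.Icc (-1 : ℝ) 1 by simp) hx
      rw [Real.norm_eq_abs, Real.norm_eq_abs] at this
      have h1 : |x - 0| ≤ 1 := by rw [sub_zero]; exact abs_le.2 hx
      have e : f x - (Q + Polynomial.C (f 0 - Q.eval 0)).eval x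
        = f x - Q.eval x - (f 0 - Q.eval 0) := by simp; ring
      rw [e]
      nlinarith

/-- δ in the angular variable -/
noncomputable def del (m : ℕ) (x : ℝ) : ℝ := Real.sqrt (1 - x ^ 2) / m + 1 / m ^ 2

lemma del_cos (m : ℕ) (θ : ℝ) : del m (cos θ) = |sin θ| / m + 1 / m ^ 2 := by
  rw [del, ← abs_sin_eq_sqrt_one_sub_cos_sq]

lemma del_pos (m : ℕ) (hm : 1 ≤ m) (x : ℝ) : 0 < del m x := by
  have : (0 : ℝ) < m := by exact_mod_cast hm
  unfold del
  positivity

lemma abs_sin_add_le (θ s : ℝ) : |sin (θ + s)| ≤ |sin θ| + |s| := by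
  have h := abs_sin_sub_sin_le (θ + s) θ
  rw [add_sub_cancel_left] at h
  have := abs_sub_abs_le_abs_sub (sin (θ + s)) (sin θ)
  linarith

lemma del_shift (m : ℕ) (hm : 1 ≤ m) (θ s : ℝ) :
    del m (cos (θ + s)) ≤ (1 + m * |s|) * del m (cos θ) := by
  have hm0 : (0 : ℝ) < m := by exact_mod_cast hm
  rw [del_cos, del_cos]
  have h := abs_sin_add_le θ s
  calc |sin (θ + s)| / m + 1 / m ^ 2 ≤ (|sin θ| + |s|) / m + 1 / m ^ 2 := by gcongr
    _ = |sin θ| / m + 1 / m ^ 2 + m * |s| * (1 / m ^ 2) := by field_simp; ring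
    _ ≤ |sin θ| / m + 1 / m ^ 2 + m * |s| * (|sin θ| / m + 1 / m ^ 2) := by
      gcongr
      have : 0 ≤ |sin θ| / m := by positivity
      linarith
    _ = _ := by ring

lemma sin_le_del (m : ℕ) (hm : 1 ≤ m) (θ s : ℝ) :
    |sin (θ + s)| ≤ m * ((1 + m * |s|) * del m (cos θ)) := by
  have hm0 : (0 : ℝ) < m := by exact_mod_cast hm
  refine le_trans ?_ (mul_le_mul_of_nonneg_left (del_shift m hm θ s) hm0.le)
  rw [del_cos, mul_add, mul_div_cancel₀ _ hm0.ne']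
  have : 0 ≤ (m : ℝ) * (1 / m ^ 2) := by positivity
  linarith

lemma cos_diff_le (m : ℕ) (hm : 1 ≤ m) (θ t : ℝ) :
    |cos θ - cos (θ + t)| ≤ (m * |t| * (1 + m * |t|)) * del m (cos θ) := by
  have hm0 : (0 : ℝ) < m := by exact_mod_cast hm
  have hd : ∀ s ∈ Set.Icc (-|t|) |t|, HasDerivWithinAt (fun s => cos (θ + s)) (-sin (θ + s))
      (Set.Icc (-|t|) |t|) s := by
    intro s _
    have := ((hasDerivAt_cos (θ + s)).comp_const_add θ s)
    exact this.hasDerivWithinAt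
  have hdel := del_pos m hm (cos θ)
  have := (convex_Icc (-|t|) |t|).norm_image_sub_le_of_norm_hasDerivWithin_le
    (C := m * ((1 + m * |t|) * del m (cos θ))) hd
    (fun s hs => by
      rw [Real.norm_eq_abs, abs_neg]
      refine (sin_le_del m hm θ s).trans ?_
      have := abs_le.2 ⟨hs.1, hs.2⟩
      gcongr)
    (show (0 : ℝ) ∈ Set.Icc (-|t|) |t| by simp) ⟨neg_abs_le t, le_abs_self t⟩
  rw [Real.norm_eq_abs, Real.norm_eq_abs, add_zero, sub_zero, abs_sub_comm] at this
  linarith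

lemma main_claim (r : ℕ) : ∃ c : ℝ, 0 ≤ c ∧ ∃ d : ℕ, ∀ f : ℝ → ℝ,
    ContDiffOn ℝ r f (Set.Icc (-1 : ℝ) 1) → ∀ m : ℕ, 1 ≤ m →
    ∃ p : Polynomial ℝ, p.natDegree ≤ d * m ∧ ∀ θ : ℝ,
      |f (cos θ) - p.eval (cos θ)| ≤ c * (del m (cos θ) ^ r *
        modulusOn (iteratedDerivWithin r f (Set.Icc (-1 : ℝ) 1)) (del m (cos θ))) := by
  have hu := uniqueDiffOn_Icc (show (-1 : ℝ) < 1 by norm_num)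
  have hcos : ∀ u, cos u ∈ Set.Icc (-1 : ℝ) 1 := fun u => ⟨neg_one_le_cos u, cos_le_one u⟩
  induction r with
  | zero =>
    obtain ⟨C, hC, d, hk⟩ := kernel_lemma 2
    refine ⟨C, hC, d, ?_⟩
    intro f hf m hm
    have hm0 : (0 : ℝ) < m := by exact_mod_cast hm
    obtain ⟨p, hpd, hp⟩ := hk m hm f hf.continuousOn
    refine ⟨p, hpd, fun θ => hp θ _ fun t => ?_⟩
    rw [iteratedDerivWithin_zero, pow_zero, one_mul]
    have hdel := del_pos m hm (cos θ)
    refine (modulusOn_lip f hf.continuousOn hdel (hcos _) (hcos _)).trans ?_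
    rw [mul_comm]
    have := modulusOn_nonneg f (del m (cos θ))
    gcongr
    have h1 : |cos θ - cos (θ + t)| / del m (cos θ) ≤ m * |t| * (1 + m * |t|) := by
      rw [div_le_iff₀ hdel]; exact cos_diff_le m hm θ t
    have : 0 ≤ m * |t| := by positivity
    nlinarith
  | succ r ih =>
    obtain ⟨c, hc, d, ih⟩ := ih
    obtain ⟨C, hC, d', hk⟩ := kernel_lemma (r + 3)
    refine ⟨C * (2 * c), by positivity, d + 1 + d', ?_⟩
    intro f hf m hm
    have hm0 : (0 : ℝ) < m := by exact_mod_cast hm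
    have hf' := hf.derivWithin hu (show ((r : ℕ) : WithTop ℕ∞) + 1 ≤ ((r + 1 : ℕ) : WithTop ℕ∞) by norm_cast)
    obtain ⟨q, hqd, hq⟩ := ih (derivWithin f (Set.Icc (-1 : ℝ) 1)) hf' m hm
    obtain ⟨Q, hQ, hQd⟩ := exists_antideriv q
    rw [iteratedDerivWithin_succ']
    have hFc := hf'.continuousOn_iteratedDerivWithin le_rfl hu
    set F := iteratedDerivWithin r (derivWithin f (Set.Icc (-1 : ℝ) 1)) (Set.Icc (-1 : ℝ) 1) with hF
    obtain ⟨p, hpd, hp⟩ := hk m hm (fun z => f z - Q.eval z)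
      (hf.continuousOn.sub Q.continuous.continuousOn)
    refine ⟨Q + p, ?_, ?_⟩
    · refine (Polynomial.natDegree_add_le _ _).trans ?_
      have e : (d + 1 + d') * m = d * m + m + d' * m := by ring
      rw [e]
      refine max_le ?_ ?_ <;> omega
    · intro θ
      set D := del m (cos θ) with hD
      have hDpos : 0 < D := del_pos m hm (cos θ)
      have hw := modulusOn_nonneg F D
      have e : f (cos θ) - (Q + p).eval (cos θ) = f (cos θ) - Q.eval (cos θ) - p.eval (cos θ) := by
        simp; ring
      rw [e, mul_assoc]
      refine hp θ _ fun t => ?_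
      have hd : ∀ s ∈ Set.Icc (-|t|) |t|, HasDerivWithinAt
          (fun s => f (cos (θ + s)) - Q.eval (cos (θ + s)))
          ((derivWithin f (Set.Icc (-1 : ℝ) 1) (cos (θ + s)) - q.eval (cos (θ + s)))
            * (-sin (θ + s))) (Set.Icc (-|t|) |t|) s := by
        intro s _
        have h1 : HasDerivWithinAt (fun z => f z - Q.eval z)
            (derivWithin f (Set.Icc (-1 : ℝ) 1) (cos (θ + s)) - q.eval (cos (θ + s)))
            (Set.Icc (-1 : ℝ) 1) (cos (θ + s)) := by
          refine HasDerivWithinAt.sub ?_ ?_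
          · exact ((hf.differentiableOn (by simp)) _ (hcos _)).hasDerivWithinAt
          · rw [← hQ]; exact (Q.hasDerivAt _).hasDerivWithinAt
        have h2 := ((hasDerivAt_cos (θ + s)).comp_const_add θ s)
        have h3 := HasDerivWithinAt.comp s (h := fun s => cos (θ + s)) h1
          (h2.hasDerivWithinAt (s := Set.Icc (-|t|) |t|)) (fun u _ => hcos _)
        exact h3
      set l := 1 + m * |t| with hl
      have hl1 : 1 ≤ l := by
        have : 0 ≤ m * |t| := by positivity
        linarith
      have hbound : ∀ s ∈ Set.Icc (-|t|) |t|,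
          ‖(derivWithin f (Set.Icc (-1 : ℝ) 1) (cos (θ + s)) - q.eval (cos (θ + s)))
            * (-sin (θ + s))‖ ≤ (c * ((l * D) ^ r * ((l + 1) * modulusOn F D))) * (m * (l * D)) := by
        intro s hs
        have hst : |s| ≤ |t| := abs_le.2 ⟨hs.1, hs.2⟩
        have hls : 1 + m * |s| ≤ l := by rw [hl]; gcongr
        have hdl : del m (cos (θ + s)) ≤ l * D :=
          (del_shift m hm θ s).trans (by rw [← hD]; gcongr)
        have hdp := del_pos m hm (cos (θ + s))
        rw [norm_mul, norm_neg, Real.norm_eq_abs, Real.norm_eq_abs]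
        refine mul_le_mul ?_ ?_ (abs_nonneg _) (by positivity)
        · refine (hq (θ + s)).trans ?_
          have h1 := modulusOn_scale F hFc hDpos (by linarith) hdl
          have h2 := modulusOn_nonneg F (del m (cos (θ + s)))
          gcongr
        · refine (sin_le_del m hm θ s).trans ?_
          rw [← hD]; gcongr
      have := (convex_Icc (-|t|) |t|).norm_image_sub_le_of_norm_hasDerivWithin_le hd hbound
        (show (0 : ℝ) ∈ Set.Icc (-|t|) |t| by simp) ⟨neg_abs_le t, le_abs_self t⟩
      rw [Real.norm_eq_abs, Real.norm_eq_abs, add_zero, sub_zero, abs_sub_comm] at this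
      refine this.trans ?_
      calc c * ((l * D) ^ r * ((l + 1) * modulusOn F D)) * (m * (l * D)) * |t|
          = (m * |t|) * (l + 1) * (c * (D ^ (r + 1) * modulusOn F D) * l ^ (r + 1)) := by
            rw [mul_pow]; ring
        _ ≤ l * (2 * l) * (c * (D ^ (r + 1) * modulusOn F D) * l ^ (r + 1)) := by
            gcongr
            · linarith
            · linarith
        _ = 2 * c * (D ^ (r + 1) * modulusOn F D) * l ^ (r + 3) := by ring

/-- **Timan.** For every `r` there is `c(r)` such that every `r` times continuously
differentiable `f : [−1,1] → ℝ` admits, for each `n ≥ r+1`, a polynomial `p_n` of degree at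
most `n` with the pointwise estimate
`|f(x) − p_n(x)| ≤ c(r)·δ_n(x)^r·ω(f^{(r)}; δ_n(x))`, `δ_n(x) = √(1−x²)/n + 1/n²`. -/
theorem timan_pointwise_approx (r : ℕ) :
    ∃ c : ℝ, ∀ f : ℝ → ℝ, ContDiffOn ℝ r f (Set.Icc (-1 : ℝ) 1) →
      ∀ n : ℕ, r + 1 ≤ n →
        ∃ p : Polynomial ℝ, p.natDegree ≤ n ∧
          ∀ x ∈ Set.Icc (-1 : ℝ) 1,
            |f x - p.eval x| ≤
              c * (Real.sqrt (1 - x ^ 2) / n + 1 / n ^ 2) ^ r *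
                modulusOn (iteratedDerivWithin r f (Set.Icc (-1 : ℝ) 1))
                  (Real.sqrt (1 - x ^ 2) / n + 1 / n ^ 2) := by
  obtain ⟨c, hc, d₀, hmain⟩ := main_claim r
  set d := d₀ + 1 with hd
  have hd1 : (1 : ℝ) ≤ d := by exact_mod_cast (show 1 ≤ d by omega)
  set c₁ : ℝ := c * ((4 * d ^ 2) ^ r * (4 * d ^ 2 + 1)) with hc₁
  set c₂ : ℝ := (d ^ 2) ^ r * (2 * d ^ 2 + 1) with hc₂
  have hc₁0 : 0 ≤ c₁ := by positivity
  have hc₂0 : 0 ≤ c₂ := by positivity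
  refine ⟨c₁ + c₂, ?_⟩
  intro f hf n hn
  have hu := uniqueDiffOn_Icc (show (-1 : ℝ) < 1 by norm_num)
  have hFc := hf.continuousOn_iteratedDerivWithin le_rfl hu
  set F := iteratedDerivWithin r f (Set.Icc (-1 : ℝ) 1) with hF
  have hn1 : 1 ≤ n := by omega
  have hn0 : (0 : ℝ) < n := by exact_mod_cast hn1
  by_cases hnd : d ≤ n
  · set m := n / d with hm
    have hm1 : 1 ≤ m := (Nat.one_le_div_iff (by omega)).2 hnd
    have hm0 : (0 : ℝ) < m := by exact_mod_cast hm1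
    obtain ⟨p, hpd, hp⟩ := hmain f hf m hm1
    refine ⟨p, ?_, ?_⟩
    · have h1 : d * m ≤ n := Nat.mul_div_le n d
      have h2 : d₀ * m ≤ d * m := Nat.mul_le_mul_right _ (by omega)
      omega
    · intro x hx
      change _ ≤ (c₁ + c₂) * del n x ^ r * modulusOn F (del n x)
      have hb := hp (arccos x)
      rw [cos_arccos hx.1 hx.2] at hb
      have hw := modulusOn_nonneg F (del n x)
      have hDn := del_pos n hn1 x
      have hDm := del_pos m hm1 x
      have hmn : (n : ℝ) ≤ 2 * d * m := by
        have h1 : n < d * (m + 1) := Nat.lt_mul_div_succ n (by omega)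
        have h2 : n ≤ 2 * d * m := by nlinarith
        exact_mod_cast h2
      have hi : 1 / (m : ℝ) ≤ 2 * d * (1 / n) := by
        rw [mul_one_div, div_le_div_iff₀ hm0 hn0]; linarith
      have hdel : del m x ≤ 4 * d ^ 2 * del n x := by
        unfold del
        have hs := Real.sqrt_nonneg (1 - x ^ 2)
        have e1 : Real.sqrt (1 - x ^ 2) / m ≤ 4 * d ^ 2 * (Real.sqrt (1 - x ^ 2) / n) := by
          calc Real.sqrt (1 - x ^ 2) / m = Real.sqrt (1 - x ^ 2) * (1 / m) := by ring
            _ ≤ Real.sqrt (1 - x ^ 2) * (2 * d * (1 / n)) := by gcongr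
            _ = 2 * d * (Real.sqrt (1 - x ^ 2) / n) := by ring
            _ ≤ _ := by
              gcongr ?_ * _
              nlinarith
        have e2 : 1 / (m : ℝ) ^ 2 ≤ 4 * d ^ 2 * (1 / n ^ 2) := by
          calc 1 / (m : ℝ) ^ 2 = (1 / (m : ℝ)) ^ 2 := by ring
            _ ≤ (2 * (d : ℝ) * (1 / (n : ℝ))) ^ 2 := by gcongr
            _ = _ := by ring
        linarith
      have hms := modulusOn_scale F hFc hDn (by positivity) hdel
      have hwm := modulusOn_nonneg F (del m x)
      calc |f x - p.eval x| ≤ c * (del m x ^ r * modulusOn F (del m x)) := hb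
        _ ≤ c * ((4 * d ^ 2 * del n x) ^ r * ((4 * d ^ 2 + 1) * modulusOn F (del n x))) := by
          gcongr
        _ = c₁ * del n x ^ r * modulusOn F (del n x) := by rw [hc₁, mul_pow]; ring
        _ ≤ (c₁ + c₂) * del n x ^ r * modulusOn F (del n x) := by
          gcongr; linarith
  · obtain ⟨p, hpd, hp⟩ := small_claim r f hf
    refine ⟨p, by omega, ?_⟩
    intro x hx
    change _ ≤ (c₁ + c₂) * del n x ^ r * modulusOn F (del n x)
    have hw := modulusOn_nonneg F (del n x)
    have hDn := del_pos n hn1 x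
    have hnd' : (n : ℝ) ≤ d := by exact_mod_cast (show n ≤ d by omega)
    have hD1 : 1 ≤ d ^ 2 * del n x := by
      have h1 : 1 / (n : ℝ) ^ 2 ≤ del n x := by
        unfold del
        have : 0 ≤ Real.sqrt (1 - x ^ 2) / n := by positivity
        linarith
      have h2 : (1 : ℝ) = n ^ 2 * (1 / n ^ 2) := by field_simp
      rw [h2]
      gcongr
    have hb := hp ((2 * d ^ 2 + 1) * modulusOn F (del n x)) ?_ x hx
    · calc |f x - p.eval x| ≤ 1 * ((2 * d ^ 2 + 1) * modulusOn F (del n x)) := by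
            rw [one_mul]; exact hb
        _ ≤ (d ^ 2 * del n x) ^ r * ((2 * d ^ 2 + 1) * modulusOn F (del n x)) := by
            have := one_le_pow₀ (n := r) hD1
            gcongr
        _ = c₂ * del n x ^ r * modulusOn F (del n x) := by rw [hc₂, mul_pow]; ring
        _ ≤ (c₁ + c₂) * del n x ^ r * modulusOn F (del n x) := by
          gcongr; linarith
    · intro a ha b hb
      refine (modulusOn_lip F hFc hDn ha hb).trans ?_
      gcongr
      rw [div_le_iff₀ hDn]
      have : |a - b| ≤ 2 := abs_le.2 ⟨by linarith [ha.1, hb.2], by linarith [ha.2, hb.1]⟩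
      nlinarith
end
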